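/- Let A be the Artin group of type D_4 and let (x_0,…,x_5) be a type I 6-cycle. Then there exists a left coset z of A_â or of A_b̂ such that z ∩ x_1 ≠ ∅, z ∩ x_3 ≠ ∅ and z ∩ x_5 ≠ ∅ (every type I 6-cycle satisfies property (*)). -/

import Mathlib

/-!
The Artin group of type `D₄`, with generators `a, b, c, d`, where `d` is the central node of
the Dynkin diagram: relations `ada = dad`, `bdb = dbd`, `cdc = dcd`, `ab = ba`, `ac = ca`,
`bc = cb`.
-/

open Pointwise

namespace D4Artin

/-- The generators of the `D₄` Artin group. -/
inductive Gen : Type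
  | a | b | c | d
deriving DecidableEq

open Gen

/-- The defining relators of the `D₄` Artin group: a braid relation `sts = tst` whenever one of
`s, t` is the central node `d`, and commutation `st = ts` otherwise. -/
def Rels : Set (FreeGroup Gen) :=
  { r | ∃ s t : Gen, s ≠ t ∧
      (((s = d ∨ t = d) ∧
          r = FreeGroup.of s * FreeGroup.of t * FreeGroup.of s *
              (FreeGroup.of t * FreeGroup.of s * FreeGroup.of t)⁻¹) ∨
        ((s ≠ d ∧ t ≠ d) ∧
          r = FreeGroup.of s * FreeGroup.of t * (FreeGroup.of s)⁻¹ * (FreeGroup.of t)⁻¹)) }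

/-- The Artin group of type `D₄`. -/
abbrev Artin : Type := PresentedGroup Rels

/-- The generators, as elements of the Artin group. -/
def gen (s : Gen) : Artin := PresentedGroup.of s

/-- The standard parabolic subgroup `A_ŝ` generated by the three generators other than `s`. -/
def Ahat (s : Gen) : Subgroup Artin :=
  Subgroup.closure { x | ∃ t : Gen, t ≠ s ∧ x = gen t }

/-- `X` is a left coset of the subgroup `H`. -/
def IsCosetOf (X : Set Artin) (H : Subgroup Artin) : Prop :=
  ∃ g : Artin, X = g • (H : Set Artin)

/-- A type I 6-cycle: `x 0, x 2, x 4` are pairwise distinct left cosets of `A_â`,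
`x 1, x 3, x 5` are pairwise distinct left cosets of `A_ĉ`, and consecutive cosets
(indices mod 6) have nonempty intersection. -/
def TypeI (x : Fin 6 → Set Artin) : Prop :=
  IsCosetOf (x 0) (Ahat a) ∧ IsCosetOf (x 2) (Ahat a) ∧ IsCosetOf (x 4) (Ahat a) ∧
  IsCosetOf (x 1) (Ahat c) ∧ IsCosetOf (x 3) (Ahat c) ∧ IsCosetOf (x 5) (Ahat c) ∧
  x 0 ≠ x 2 ∧ x 0 ≠ x 4 ∧ x 2 ≠ x 4 ∧
  x 1 ≠ x 3 ∧ x 1 ≠ x 5 ∧ x 3 ≠ x 5 ∧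
  ∀ i : Fin 6, (x i ∩ x (i + 1)).Nonempty

end D4Artin

namespace D4Artin

section Splitting

variable {U : Type*} [Group U]

/-- A splitting `U = P * ⟨r⟩` of a group as a free product with `r` an involution, recorded by the
set `S` of the elements whose normal form starts with `r`. -/
structure Splitting (P : Subgroup U) (r : U) (S : Set U) : Prop where
  one_notMem : (1 : U) ∉ S
  mem : r ∈ S
  sq : r * r = 1
  mul_mem_iff : ∀ p ∈ P, ∀ w, w * p ∈ S ↔ w ∈ S
  mul_self_mem_iff : ∀ w, w ≠ 1 → w ≠ r → (w * r ∈ S ↔ w ∈ S)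
  closure_eq : Subgroup.closure (insert r (P : Set U)) = ⊤

/-- A set is almost invariant if each right translation changes it in finitely many elements. -/
def AlmostInvariant (Z : Set U) : Prop :=
  ∀ g : U, {w | ¬(w * g ∈ Z ↔ w ∈ Z)}.Finite

theorem AlmostInvariant.inter {Y Z : Set U} (hY : AlmostInvariant Y) (hZ : AlmostInvariant Z) :
    AlmostInvariant (Y ∩ Z) := by
  intro g
  refine ((hY g).union (hZ g)).subset fun w hw => ?_
  simp only [Set.mem_ofPred_eq, Set.mem_inter_iff, Set.mem_union] at hw ⊢
  tauto

theorem AlmostInvariant.preimage_mul_left {Z : Set U} (hZ : AlmostInvariant Z) (h : U) :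
    AlmostInvariant {w | h * w ∈ Z} := by
  intro g
  refine ((hZ g).preimage (mul_right_injective h).injOn).subset fun w hw => ?_
  simpa [mul_assoc] using hw

theorem AlmostInvariant.finite {Z : Set U} (hZ : AlmostInvariant Z) (u v : U) :
    {w | ¬(w * u ∈ Z ↔ w * v ∈ Z)}.Finite := by
  refine ((hZ (v⁻¹ * u)).preimage (mul_left_injective v).injOn).subset fun w hw => ?_
  simpa [mul_assoc] using hw

theorem almostInvariant_empty : AlmostInvariant (∅ : Set U) := fun g => by simp

/-- The indicator of an almost invariant set has vanishing total variation along every right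
translation, when the group is generated by involutions. -/
theorem AlmostInvariant.finsum_indicator_eq_zero {T : Set U} (hT : Subgroup.closure T = ⊤)
    (hsq : ∀ t ∈ T, t * t = 1) {Z : Set U} (hZ : AlmostInvariant Z) (u v : U) :
    ∑ᶠ w, (Z.indicator (1 : U → ℤ) (w * u) - Z.indicator (1 : U → ℤ) (w * v)) = 0 := by
  have key : ∀ g : U, ∑ᶠ w, (Z.indicator (1 : U → ℤ) (w * g) - Z.indicator (1 : U → ℤ) w) = 0 := by
    have shift : ∀ (f : U → ℤ) (g : U), ∑ᶠ w, f (w * g) = ∑ᶠ w, f w := fun f g =>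
      finsum_comp_equiv (Equiv.mulRight g)
    have fin : ∀ u v : U, (Function.support fun w =>
        Z.indicator (1 : U → ℤ) (w * u) - Z.indicator (1 : U → ℤ) (w * v)).Finite := by
      intro u v
      refine (hZ.finite u v).subset fun w hw => ?_
      simp only [Function.mem_support, Set.mem_ofPred_eq] at hw ⊢
      contrapose! hw
      simp only [Set.indicator]
      by_cases h : w * u ∈ Z
      · simp [h, hw.1 h]
      · simp [h, mt hw.2 h]
    intro g
    have hg : g ∈ Subgroup.closure T := hT ▸ Subgroup.mem_top g
    induction hg using Subgroup.closure_induction with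
    | mem t ht =>
      have h := shift (fun w => Z.indicator (1 : U → ℤ) (w * t) - Z.indicator (1 : U → ℤ) w) t
      simp only [mul_assoc, hsq t ht, mul_one] at h
      have h' : ∑ᶠ w, (Z.indicator (1 : U → ℤ) w - Z.indicator (1 : U → ℤ) (w * t)) =
          -∑ᶠ w, (Z.indicator (1 : U → ℤ) (w * t) - Z.indicator (1 : U → ℤ) w) := by
        rw [← finsum_neg_distrib]; simp
      omega
    | one => simp
    | mul x y _ _ hx hy =>
      have h := shift (fun w => Z.indicator (1 : U → ℤ) (w * y) - Z.indicator (1 : U → ℤ) w) x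
      have h' := finsum_add_distrib (fin (x * y) x)
        (by simpa [Function.HasFiniteSupport] using fin x 1)
      simp only [mul_assoc] at h
      rw [h, hy, hx] at h'
      simpa using h'
    | inv x _ hx =>
      have h := shift (fun w => Z.indicator (1 : U → ℤ) (w * x⁻¹) - Z.indicator (1 : U → ℤ) w) x
      simp only [mul_inv_cancel_right] at h
      rw [← h, ← neg_eq_zero, ← finsum_neg_distrib]
      simpa using hx
  have h := finsum_comp_equiv (Equiv.mulRight v)
    (f := fun w => Z.indicator (1 : U → ℤ) (w * (v⁻¹ * u)) - Z.indicator (1 : U → ℤ) w)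
  rw [key] at h
  simpa [mul_assoc] using h

namespace Splitting

variable {P : Subgroup U} {r : U} {S : Set U}

theorem eq_empty_or_univ (h : Splitting P r S) {D : Set U} (hP : ∀ p ∈ P, ∀ w ∈ D, w * p ∈ D)
    (hr : ∀ w ∈ D, w * r ∈ D) : D = ∅ ∨ D = Set.univ := by
  rcases D.eq_empty_or_nonempty with hD | ⟨u, hu⟩
  · exact Or.inl hD
  have key : ∀ g : U, ∀ w ∈ D, w * g ∈ D := by
    intro g
    have hg : g ∈ Subgroup.closure (insert r (P : Set U)) := h.closure_eq ▸ Subgroup.mem_top g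
    induction hg using Subgroup.closure_induction'' with
    | one => simp
    | mem x hx =>
      rcases hx with rfl | hx
      exacts [hr, hP x hx]
    | inv_mem x hx =>
      rcases hx with rfl | hx
      · rwa [inv_eq_of_mul_eq_one_left h.sq]
      · exact hP _ (inv_mem hx)
    | mul x y _ _ hx hy => exact fun w hw => by simpa [mul_assoc] using hy _ (hx w hw)
  refine Or.inr (Set.eq_univ_of_forall fun w => ?_)
  simpa using key (u⁻¹ * w) u hu

theorem mul_left_mem_iff (h : Splitting P r S) {g : U} (w : U) (h1 : w ≠ g) (h2 : w ≠ g * r) :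
    g⁻¹ * (w * r) ∈ S ↔ g⁻¹ * w ∈ S := by
  rw [← mul_assoc]
  refine h.mul_self_mem_iff _ (fun e => h1 ?_) fun e => h2 ?_
  · rw [inv_mul_eq_one] at e; exact e.symm
  · rw [← e]; simp

theorem notMem_of_mem (h : Splitting P r S) {p : U} (hp : p ∈ P) : p ∉ S := fun hS =>
  h.one_notMem (by simpa using (h.mul_mem_iff p hp 1).1 (by simpa using hS))

theorem almostInvariant (h : Splitting P r S) : AlmostInvariant S := by
  intro g
  have hg : g ∈ Subgroup.closure (insert r (P : Set U)) := h.closure_eq ▸ Subgroup.mem_top g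
  induction hg using Subgroup.closure_induction with
  | mem x hx =>
    rcases hx with rfl | hx
    · refine (Set.toFinite {1, x}).subset fun w hw => ?_
      by_contra hc
      simp only [Set.mem_insert_iff, Set.mem_singleton_iff, not_or] at hc
      exact hw (h.mul_self_mem_iff w hc.1 hc.2)
    · convert Set.finite_empty
      ext w
      simp [h.mul_mem_iff x hx w]
  | one => simp
  | mul x y _ _ hx hy =>
    refine (hx.union (hy.preimage (mul_left_injective x).injOn)).subset fun w hw => ?_
    simp only [Set.mem_ofPred_eq, Set.mem_union, Set.mem_preimage, mul_assoc] at hw ⊢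
    tauto
  | inv x _ hx =>
    refine (hx.preimage (mul_left_injective x⁻¹).injOn).subset fun w hw => ?_
    simp only [Set.mem_ofPred_eq, Set.mem_preimage, mul_assoc, inv_mul_cancel, mul_one] at hw ⊢
    tauto

/-- Every element lies in `P` or in the branch `p S` at some `p ∈ P`. -/
theorem exists_branch (h : Splitting P r S) (w : U) : w ∈ P ∨ ∃ p ∈ P, p⁻¹ * w ∈ S := by
  have := h.eq_empty_or_univ (D := {w | w ∈ P ∨ ∃ p ∈ P, p⁻¹ * w ∈ S}) ?_ ?_
  · rcases this with e | e
    · exact absurd (show (1 : U) ∈ {w | w ∈ P ∨ ∃ p ∈ P, p⁻¹ * w ∈ S} from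
        Or.inl P.one_mem) (by simp [e])
    · exact Set.eq_univ_iff_forall.1 e w
  · rintro p hp w (hw | ⟨q, hq, hw⟩)
    · exact Or.inl (mul_mem hw hp)
    · refine Or.inr ⟨q, hq, ?_⟩
      rw [← mul_assoc]; exact (h.mul_mem_iff p hp _).2 hw
  · rintro w (hw | ⟨q, hq, hw⟩)
    · exact Or.inr ⟨w, hw, by simpa using h.mem⟩
    · by_cases h2 : w = q * r
      · left; simpa [h2, mul_assoc, h.sq] using hq
      · refine Or.inr ⟨q, hq, (h.mul_left_mem_iff w ?_ h2).2 hw⟩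
        rintro rfl
        exact h.one_notMem (by simpa using hw)

theorem branch_unique (h : Splitting P r S) {p q w : U} (hp : p ∈ P) (hq : q ∈ P)
    (hpw : p⁻¹ * w ∈ S) (hqw : q⁻¹ * w ∈ S) : p = q := by
  by_contra hne
  have aux : ∀ {p q : U}, p ∈ P → q ∈ P → p ≠ q → q⁻¹ * (p * r) ∉ S := by
    intro p q hp hq hne hS
    have : q⁻¹ * p ∈ P := mul_mem (inv_mem hq) hp
    refine h.notMem_of_mem this ((h.mul_left_mem_iff p hne ?_).1 hS)
    rintro rfl
    exact h.notMem_of_mem this (by simpa using h.mem)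
  have := h.eq_empty_or_univ (D := {w | p⁻¹ * w ∈ S ∧ q⁻¹ * w ∈ S}) ?_ ?_
  · rcases this with e | e
    · exact absurd (show w ∈ {w | p⁻¹ * w ∈ S ∧ q⁻¹ * w ∈ S} from ⟨hpw, hqw⟩) (by simp [e])
    · have : p ∈ {w | p⁻¹ * w ∈ S ∧ q⁻¹ * w ∈ S} := e ▸ Set.mem_univ p
      exact h.one_notMem (by simpa using this.1)
  · rintro s hs w ⟨h1, h2⟩
    simp only [Set.mem_ofPred_eq, ← mul_assoc]
    exact ⟨(h.mul_mem_iff s hs _).2 h1, (h.mul_mem_iff s hs _).2 h2⟩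
  · rintro w ⟨h1, h2⟩
    have n1 : w ≠ p := by rintro rfl; exact h.one_notMem (by simpa using h1)
    have n2 : w ≠ q := by rintro rfl; exact h.one_notMem (by simpa using h2)
    have n3 : w ≠ p * r := by rintro rfl; exact aux hp hq hne h2
    have n4 : w ≠ q * r := by rintro rfl; exact aux hq hp (Ne.symm hne) h1
    exact ⟨(h.mul_left_mem_iff w n1 n3).2 h1, (h.mul_left_mem_iff w n2 n4).2 h2⟩

theorem mul_self_left_mem_iff (h : Splitting P r S) (w : U) : r * w ∈ S ↔ w ∉ S := by
  have hr : r⁻¹ = r := inv_eq_of_mul_eq_one_left h.sq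
  have step : ∀ w, w ≠ 1 → w ≠ r → (r * (w * r) ∈ S ↔ r * w ∈ S) := fun w h1 h2 => by
    simpa only [hr] using h.mul_left_mem_iff (g := r) w h2 (by rwa [h.sq])
  have h1 := h.eq_empty_or_univ (D := {w | r * w ∈ S ↔ w ∉ S}) ?_ ?_
  · have : (1 : U) ∈ {w | r * w ∈ S ↔ w ∉ S} := by simp [h.mem, h.one_notMem]
    rcases h1 with e | e
    · simp [e] at this
    · exact Set.eq_univ_iff_forall.1 e w
  · intro p hp w hw
    simp only [Set.mem_ofPred_eq, ← mul_assoc, h.mul_mem_iff p hp]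
    exact hw
  · intro w hw
    by_cases h1 : w = 1
    · simp [h1, h.sq, h.mem, h.one_notMem]
    by_cases h2 : w = r
    · simp [h2, h.sq, h.mem, h.one_notMem]
    simpa only [Set.mem_ofPred_eq, step w h1 h2, h.mul_self_mem_iff w h1 h2] using hw

/-- Two walls of a splitting do not cross. -/
theorem separates_of_separates (h : Splitting P r S) {g u v : U} (hv : v ∈ S) (hu : u ∉ S)
    (hg : ¬(g⁻¹ * u ∈ S ↔ g⁻¹ ∈ S)) : ¬(g⁻¹ * u ∈ S ↔ g⁻¹ * v ∈ S) := by
  have hr : r⁻¹ = r := inv_eq_of_mul_eq_one_left h.sq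
  by_cases g1 : g = 1
  · simp [g1, hu, h.one_notMem] at hg
  by_cases g2 : g = r
  · simp [g2, hr, h.mul_self_left_mem_iff, hu, hv]
  have gr : g⁻¹ * r ∈ S ↔ g⁻¹ ∈ S := h.mul_self_mem_iff _ (by simpa using g1)
    fun e => g2 (by rw [← hr, ← e, inv_inv])
  have closed : ∀ D : Set U, (∀ w ∈ D, ∀ z, (z ∈ S ↔ w ∈ S) → (g⁻¹ * z ∈ S ↔ g⁻¹ * w ∈ S) → z ∈ D) →
      (1 : U) ∉ D → r ∉ D → g ∉ D → g * r ∉ D → D = ∅ := by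
    intro D hD d1 d2 d3 d4
    refine (h.eq_empty_or_univ ?_ ?_).resolve_right fun e => d1 (e ▸ Set.mem_univ _)
    · intro p hp w hw
      refine hD w hw _ (h.mul_mem_iff p hp w) ?_
      rw [← mul_assoc]; exact h.mul_mem_iff p hp _
    · intro w hw
      exact hD w hw _ (h.mul_self_mem_iff w (fun e => d1 (e ▸ hw)) fun e => d2 (e ▸ hw))
        (h.mul_left_mem_iff w (fun e => d3 (e ▸ hw)) fun e => d4 (e ▸ hw))
  have gS := h.mul_self_mem_iff g g1 g2
  intro huv
  by_cases hgS : g ∈ S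
  · have := closed {w | w ∉ S ∧ ¬(g⁻¹ * w ∈ S ↔ g⁻¹ ∈ S)}
      (fun w hw z h1 h2 => by simp only [Set.mem_ofPred_eq, h1, h2] at hw ⊢; exact hw)
      (by simp) (by simp [h.mem]) (by simp [hgS]) (by simp [gS, hgS])
    exact Set.eq_empty_iff_forall_notMem.1 this u ⟨hu, hg⟩
  · have := closed {w | w ∈ S ∧ ¬(g⁻¹ * w ∈ S ↔ g⁻¹ ∈ S)}
      (fun w hw z h1 h2 => by simp only [Set.mem_ofPred_eq, h1, h2] at hw ⊢; exact hw)
      (by simp) (by simp [gr]) (by simp [hgS]) (by simp [gS, hgS])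
    exact Set.eq_empty_iff_forall_notMem.1 this v ⟨hv, by rwa [← huv]⟩

/-- The number of walls of a splitting separating two elements. -/
noncomputable def wallDist (S : Set U) (u v : U) : ℕ :=
  {g : U | ¬(g⁻¹ * u ∈ S ↔ g⁻¹ * v ∈ S)}.ncard

theorem wallDist_mul_left (g u v : U) : wallDist S (g * u) (g * v) = wallDist S u v := by
  rw [wallDist, wallDist,
    ← Set.ncard_image_of_injective {w : U | ¬(w⁻¹ * u ∈ S ↔ w⁻¹ * v ∈ S)} (mul_right_injective g)]
  congr 1
  refine Set.Subset.antisymm (fun w hw => ⟨g⁻¹ * w, ?_, by simp⟩) ?_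
  · simpa [mul_assoc] using hw
  · rintro _ ⟨w, hw, rfl⟩
    simpa [mul_assoc] using hw

theorem wallDist_mul_right (h : Splitting P r S) {p : U} (hp : p ∈ P) (u v : U) :
    wallDist S u (v * p) = wallDist S u v := by
  simp only [wallDist, ← mul_assoc, h.mul_mem_iff p hp]

theorem wallDist_lt (h : Splitting P r S) {u v : U} (hv : v ∈ S) (hu : u ∉ S) :
    wallDist S u 1 < wallDist S u v := by
  refine Set.ncard_lt_ncard ?_ ?_
  · refine Set.ssubset_iff_exists.2 ⟨fun g hg => ?_, 1, ?_, ?_⟩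
    · exact h.separates_of_separates hv hu (by simpa using hg)
    · simp [hu, hv]
    · simp [hu, h.one_notMem]
  · refine ((h.almostInvariant.finite u v).preimage inv_injective.injOn).subset fun g hg => hg

end Splitting
end Splitting

section Noncrossing

variable {U K : Type*} [LinearOrder K]

/-- A set is noncrossing along `κ` if membership never alternates on four successive elements. -/
def Noncrossing (κ : U → K) (Z : Set U) : Prop :=
  ∀ ⦃s t u v : U⦄, κ s ≤ κ t → κ t ≤ κ u → κ u ≤ κ v →
    ¬(s ∈ Z ∧ t ∉ Z ∧ u ∈ Z ∧ v ∉ Z) ∧ ¬(s ∉ Z ∧ t ∈ Z ∧ u ∉ Z ∧ v ∈ Z)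

theorem Noncrossing.notMem_of_mem_inter {κ : U → K} {Y Z : Set U} {s t c w : U}
    (hY : Noncrossing κ Y) (hZ : Noncrossing κ Z) (hst : κ s ≤ κ t) (htc : κ t ≤ κ c)
    (htw : κ t ≤ κ w) (hsY : s ∈ Y) (htY : t ∉ Y) (hcY : c ∉ Y) (hsZ : s ∉ Z) (htZ : t ∈ Z)
    (hcZ : c ∉ Z) (hwY : w ∈ Y) : w ∉ Z := by
  intro hwZ
  rcases le_total (κ w) (κ c) with hwc | hcw
  · exact (hY hst htw hwc).1 ⟨hsY, htY, hwY, hcY⟩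
  · exact (hZ hst htc hcw).2 ⟨hsZ, htZ, hcZ, hwZ⟩

/-- Two noncrossing sets with the same nonconstant pattern at `s` and `t` are nested between `s`
and `t`. -/
theorem Noncrossing.nested {κ : U → K} {Y Z : Set U} {s t : U} (hY : Noncrossing κ Y)
    (hZ : Noncrossing κ Z)
    (h : (s ∈ Y ∧ t ∉ Y ∧ s ∈ Z ∧ t ∉ Z) ∨ (s ∉ Y ∧ t ∈ Y ∧ s ∉ Z ∧ t ∈ Z)) :
    (∀ w, κ s ≤ κ w → κ w ≤ κ t → w ∈ Y → w ∈ Z) ∨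
      ∀ w, κ s ≤ κ w → κ w ≤ κ t → w ∈ Z → w ∈ Y := by
  by_contra! hc
  obtain ⟨⟨u, su, ut, uY, uZ⟩, v, sv, vt, vZ, vY⟩ := hc
  rcases h with ⟨sY, tY, sZ, tZ⟩ | ⟨sY, tY, sZ, tZ⟩ <;> rcases le_total (κ u) (κ v) with e | e
  · exact (hZ su e vt).1 ⟨sZ, uZ, vZ, tZ⟩
  · exact (hY sv e ut).1 ⟨sY, vY, uY, tY⟩
  · exact (hY su e vt).2 ⟨sY, uY, vY, tY⟩
  · exact (hZ sv e ut).2 ⟨sZ, vZ, uZ, tZ⟩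

end Noncrossing

section Helly

variable {U K : Type*} [Group U] [LinearOrder K]

/-- The part of the complement of the coset `C P` lying in the same branch as `t`. -/
def branch (P : Subgroup U) (S : Set U) (C t : U) : Set U :=
  {w | ∃ p ∈ P, p⁻¹ * (C⁻¹ * t) ∈ S ∧ p⁻¹ * (C⁻¹ * w) ∈ S}

namespace Splitting

variable {P : Subgroup U} {r : U} {S : Set U}

theorem branch_eq (h : Splitting P r S) (C t : U) :
    branch P S C t = ∅ ∨ ∃ p ∈ P, p⁻¹ * (C⁻¹ * t) ∈ S ∧
      branch P S C t = {w | (C * p)⁻¹ * w ∈ S} := by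
  rcases (branch P S C t).eq_empty_or_nonempty with e | ⟨w, p, hp, ht, hw⟩
  · exact Or.inl e
  refine Or.inr ⟨p, hp, ht, Set.ext fun v => ⟨?_, fun hv => ⟨p, hp, ht, ?_⟩⟩⟩
  · rintro ⟨q, hq, hqt, hqv⟩
    obtain rfl := h.branch_unique hp hq ht hqt
    simpa [mul_assoc] using hqv
  · simpa [mul_assoc] using hv

theorem almostInvariant_branch (h : Splitting P r S) (C t : U) :
    AlmostInvariant (branch P S C t) := by
  rcases h.branch_eq C t with e | ⟨p, -, -, e⟩ <;> rw [e]
  · exact almostInvariant_empty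
  · exact h.almostInvariant.preimage_mul_left _

theorem mul_mem_branch_iff (h : Splitting P r S) {C t p : U} (hp : p ∈ P) (w : U) :
    w * p ∈ branch P S C t ↔ w ∈ branch P S C t := by
  simp only [branch, Set.mem_ofPred_eq, ← mul_assoc, h.mul_mem_iff p hp]

theorem notMem_of_mem_branch (h : Splitting P r S) {C t w : U} (hw : w ∈ branch P S C t) :
    C⁻¹ * w ∉ P := by
  obtain ⟨p, hp, -, hw⟩ := hw
  exact fun hC => h.notMem_of_mem (mul_mem (inv_mem hp) hC) hw

theorem notMem_branch_self (h : Splitting P r S) {C t : U} : C ∉ branch P S C t :=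
  fun e => h.notMem_of_mem_branch e (by simp)

theorem self_mem_branch {C t w : U} (hw : w ∈ branch P S C t) : t ∈ branch P S C t := by
  obtain ⟨p, hp, ht, -⟩ := hw
  exact ⟨p, hp, ht, ht⟩

end Splitting

/-- The data of a coset `C P` crossing the wall `S₁` between the points `A` and `C`. -/
structure Crossing (P₁ : Subgroup U) (r₁ : U) (S₁ : Set U) (κ : U → K) (P : Subgroup U) (r : U)
    (S : Set U) (C : U) : Prop where
  split : Splitting P r S
  noncrossing : ∀ g, Noncrossing κ {w | g⁻¹ * w ∈ S}
  exists_mem : ∃ A ∈ P₁, C⁻¹ * A ∈ P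

/-- The wall `S₁` is a final segment for `κ` which starts at `r₁`, and `1` is minimal. -/
structure Segment (r₁ : U) (S₁ : Set U) (κ : U → K) : Prop where
  one_le : ∀ w, κ 1 ≤ κ w
  le_of_mem : ∀ w ∈ S₁, κ r₁ ≤ κ w
  le_of_notMem : ∀ w ∉ S₁, κ w ≤ κ r₁

namespace Crossing

variable {P₁ P : Subgroup U} {r₁ r C : U} {S₁ S : Set U} {κ : U → K}

theorem cover (h : Crossing P₁ r₁ S₁ κ P r S C) (h₁ : Splitting P₁ r₁ S₁) (hκ : Segment r₁ S₁ κ)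
    {w : U} (hw : ¬(w * C ∈ S₁ ↔ w ∈ S₁)) :
    C⁻¹ * (w * C) ∈ P ∨ w * C ∈ branch P S C 1 ∨ w * C ∈ branch P S C r₁ := by
  rcases h.split.exists_branch (C⁻¹ * (w * C)) with hP | ⟨p, hp, hC⟩
  · exact Or.inl hP
  obtain ⟨A, hA, hCA⟩ := h.exists_mem
  have hA' : p⁻¹ * (C⁻¹ * (w * A)) ∈ S := by
    have := (h.split.mul_mem_iff _ hCA _).2 hC
    simpa [mul_assoc] using this
  rw [← h₁.mul_mem_iff A hA w] at hw
  by_contra! hc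
  have n1 : p⁻¹ * (C⁻¹ * 1) ∉ S := fun e => hc.2.1 ⟨p, hp, e, hC⟩
  have n2 : p⁻¹ * (C⁻¹ * r₁) ∉ S := fun e => hc.2.2 ⟨p, hp, e, hC⟩
  have key : ∀ u v : U, u ∉ S₁ → v ∈ S₁ → p⁻¹ * (C⁻¹ * u) ∈ S → p⁻¹ * (C⁻¹ * v) ∈ S → False := by
    intro u v hu hv hu' hv'
    refine (h.noncrossing (C * p) (hκ.one_le u) (hκ.le_of_notMem u hu) (hκ.le_of_mem v hv)).2 ?_
    simpa [mul_assoc] using And.intro n1 ⟨hu', n2, hv'⟩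
  by_cases h' : w * C ∈ S₁
  · exact key _ _ (fun e => hw (by simp [h', e])) h' hA' hC
  · exact key _ _ h' (by by_contra e; exact hw (by simp [h', e])) hC hA'

theorem notMem_branch (h : Crossing P₁ r₁ S₁ κ P r S C) (h₁ : Splitting P₁ r₁ S₁)
    (hκ : Segment r₁ S₁ κ) (hC : C ∈ S₁) {p : U} (hp : p ∈ P) (h1 : p⁻¹ * (C⁻¹ * 1) ∈ S) :
    p⁻¹ * (C⁻¹ * r₁) ∉ S := by
  intro h2
  obtain ⟨A, hA, hCA⟩ := h.exists_mem
  refine (h.noncrossing (C * p) (hκ.one_le A) (hκ.le_of_notMem A (h₁.notMem_of_mem hA))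
    (hκ.le_of_mem C hC)).1 ?_
  have nA := h.split.notMem_of_mem (mul_mem (inv_mem hp) hCA)
  have nC := h.split.notMem_of_mem (inv_mem hp)
  simpa [mul_assoc] using And.intro h1 ⟨nA, h2, by simpa using nC⟩

theorem disjoint_branch (h : Crossing P₁ r₁ S₁ κ P r S C) (h₁ : Splitting P₁ r₁ S₁)
    (hκ : Segment r₁ S₁ κ) (hC : C ∈ S₁) {w : U} (hw : w ∈ branch P S C 1) :
    w ∉ branch P S C r₁ := by
  rintro ⟨q, hq, h2, hqw⟩
  obtain ⟨p, hp, h1, hpw⟩ := hw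
  obtain rfl := h.split.branch_unique hp hq hpw hqw
  exact h.notMem_branch h₁ hκ hC hp h1 h2

theorem noncrossing_branch (h : Crossing P₁ r₁ S₁ κ P r S C) (t : U) :
    Noncrossing κ (branch P S C t) := by
  rcases h.split.branch_eq C t with e | ⟨p, -, -, e⟩ <;> rw [e]
  · intro s t u v _ _ _
    simp
  · exact h.noncrossing _

theorem pattern_one (h : Crossing P₁ r₁ S₁ κ P r S C) (h₁ : Splitting P₁ r₁ S₁)
    (hκ : Segment r₁ S₁ κ) (hC : C ∈ S₁) {w : U} (hw : w ∈ branch P S C 1) :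
    1 ∈ branch P S C 1 ∧ r₁ ∉ branch P S C 1 :=
  ⟨Splitting.self_mem_branch hw, fun ⟨_, hp, e, e'⟩ => h.notMem_branch h₁ hκ hC hp e e'⟩

theorem pattern_self (h : Crossing P₁ r₁ S₁ κ P r S C) (h₁ : Splitting P₁ r₁ S₁)
    (hκ : Segment r₁ S₁ κ) (hC : C ∈ S₁) {w : U} (hw : w ∈ branch P S C r₁) :
    1 ∉ branch P S C r₁ ∧ r₁ ∈ branch P S C r₁ :=
  ⟨fun ⟨_, hp, e, e'⟩ => h.notMem_branch h₁ hκ hC hp e' e, Splitting.self_mem_branch hw⟩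

theorem finsum_branch (h : Crossing P₁ r₁ S₁ κ P r S C) (h₁ : Splitting P₁ r₁ S₁)
    {T : Set U} (hT : Subgroup.closure T = ⊤) (hsq : ∀ t ∈ T, t * t = 1) (t : U) :
    ∑ᶠ w, (branch P S C t).indicator (1 : U → ℤ) (w * C) *
      (S₁.indicator (1 : U → ℤ) (w * C) - S₁.indicator (1 : U → ℤ) w) = 0 := by
  obtain ⟨A, hA, hCA⟩ := h.exists_mem
  rw [← (h₁.almostInvariant.inter (h.split.almostInvariant_branch C t)).finsum_indicator_eq_zero
    hT hsq C A]
  refine finsum_congr fun w => ?_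
  have e1 := h.split.mul_mem_branch_iff (C := C) (t := t) hCA (w * C)
  have e2 := h₁.mul_mem_iff A hA w
  rw [mul_assoc, mul_inv_cancel_left] at e1
  by_cases i : w * C ∈ branch P S C t <;> by_cases j : w * C ∈ S₁ <;> by_cases k : w ∈ S₁ <;>
    simp [Set.indicator, e1, e2, i, j, k]

end Crossing

theorem Splitting.false_of_minimal {P₁ P Q : Subgroup U} {r₁ r q C : U} {S₁ S R : Set U}
    {κ : U → K} (h₁ : Splitting P₁ r₁ S₁) (hκ : Segment r₁ S₁ κ) (hC : C ∈ S₁)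
    (h : Crossing P₁ r₁ S₁ κ P r S C) (k : Crossing P₁ r₁ S₁ κ Q q R C)
    {T : Set U} (hT : Subgroup.closure T = ⊤) (hsq : ∀ t ∈ T, t * t = 1)
    (hmin : ∀ w, C⁻¹ * w ∈ P → C⁻¹ * w ∈ Q → wallDist S₁ C 1 ≤ wallDist S₁ w 1) : False := by
  classical
  set σ : U → ℤ := fun w => S₁.indicator (1 : U → ℤ) (w * C) - S₁.indicator (1 : U → ℤ) w with hσ
  have fin : {w | ¬(w * C ∈ S₁ ↔ w ∈ S₁)}.Finite := h₁.almostInvariant C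
  have zero : ∀ {w}, (w * C ∈ S₁ ↔ w ∈ S₁) → σ w = 0 := fun {w} hw => by
    by_cases i : w ∈ S₁ <;> simp [hσ, i, hw]
  have nonneg : ∀ {w}, w * C ∈ S₁ → 0 ≤ σ w := fun {w} hw => by
    by_cases i : w ∈ S₁ <;> simp [hσ, i, hw]
  have nonpos : ∀ {w}, w * C ∉ S₁ → σ w ≤ 0 := fun {w} hw => by
    by_cases i : w ∈ S₁ <;> simp [hσ, i, hw]
  set F := fin.toFinset with hF
  have toSum : ∀ f : U → ℤ, ∑ᶠ w, f w * σ w = ∑ w ∈ F, f w * σ w := fun f => by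
    refine finsum_eq_sum_of_support_subset _ fun w hw => ?_
    simp only [hF, Set.Finite.coe_toFinset]
    exact fun e => hw (by simp [zero e])
  set M := branch P S C 1 with hM
  set M' := branch P S C r₁ with hM'
  set N := branch Q R C 1 with hN
  set N' := branch Q R C r₁ with hN'
  set ι : Set U → U → ℤ := fun Z w => Z.indicator (1 : U → ℤ) (w * C) with hι
  have ι_mem : ∀ {Z : Set U} {w}, w * C ∈ Z → ι Z w = 1 := fun hw => by simp [hι, hw]
  have ι_notMem : ∀ {Z : Set U} {w}, w * C ∉ Z → ι Z w = 0 := fun hw => by simp [hι, hw]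
  have sσ : ∑ w ∈ F, σ w = 0 := by
    have := h₁.almostInvariant.finsum_indicator_eq_zero hT hsq C 1
    simp only [mul_one] at this
    simpa [toSum (fun _ => 1)] using (toSum fun _ => 1).symm.trans (by simpa using this)
  have sM : ∑ w ∈ F, ι M w * σ w = 0 := (toSum _).symm.trans (h.finsum_branch h₁ hT hsq 1)
  have sM' : ∑ w ∈ F, ι M' w * σ w = 0 := (toSum _).symm.trans (h.finsum_branch h₁ hT hsq r₁)
  have sN : ∑ w ∈ F, ι N w * σ w = 0 := (toSum _).symm.trans (k.finsum_branch h₁ hT hsq 1)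
  have sN' : ∑ w ∈ F, ι N' w * σ w = 0 := (toSum _).symm.trans (k.finsum_branch h₁ hT hsq r₁)
  have prod_nonpos : ∀ Y Z : Set U, Noncrossing κ Y → Noncrossing κ Z →
      (∀ w ∈ Y, ∀ w' ∈ Z, (1 ∈ Y ∧ r₁ ∉ Y ∧ 1 ∈ Z ∧ r₁ ∉ Z) ∨
        (1 ∉ Y ∧ r₁ ∈ Y ∧ 1 ∉ Z ∧ r₁ ∈ Z)) →
      ∑ w ∈ F, ι Y w * σ w = 0 → ∑ w ∈ F, ι Z w * σ w = 0 →
      ∑ w ∈ F, ι Y w * ι Z w * σ w ≤ 0 := by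
    intro Y Z ncY ncZ hYZ sY sZ
    have aux : ∀ Y Z : Set U, (∀ w, κ 1 ≤ κ w → κ w ≤ κ r₁ → w ∈ Y → w ∈ Z) →
        ∑ w ∈ F, ι Y w * σ w = 0 → ∑ w ∈ F, ι Y w * ι Z w * σ w ≤ 0 := by
      intro Y Z hsub sY
      rw [← sY]
      refine Finset.sum_le_sum fun w _ => ?_
      by_cases i : w * C ∈ Y <;> by_cases j : w * C ∈ Z
      · simp [ι_mem i, ι_mem j]
      · have : w * C ∈ S₁ := by
          by_contra e
          exact j (hsub _ (hκ.one_le _) (hκ.le_of_notMem _ e) i)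
        simp [ι_mem i, ι_notMem j, nonneg this]
      · simp [ι_notMem i]
      · simp [ι_notMem i]
    by_cases hne : ∃ w ∈ Y, ∃ w' ∈ Z, True
    · obtain ⟨w, hw, w', hw', -⟩ := hne
      rcases ncY.nested ncZ (hYZ w hw w' hw') with e | e
      · exact aux Y Z e sY
      · simpa only [mul_comm (ι Y _)] using aux Z Y e sZ
    · refine Finset.sum_nonpos fun w _ => ?_
      by_cases i : w * C ∈ Y <;> by_cases j : w * C ∈ Z
      · exact (hne ⟨_, i, _, j, trivial⟩).elim
      all_goals simp [ι_notMem, i, j]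
  have cross_nonpos : ∀ Y Z : Set U, Noncrossing κ Y → Noncrossing κ Z →
      (∀ w ∈ Y, ∀ w' ∈ Z, 1 ∈ Y ∧ r₁ ∉ Y ∧ 1 ∉ Z ∧ r₁ ∈ Z) → C ∉ Y → C ∉ Z →
      ∑ w ∈ F, ι Y w * ι Z w * σ w ≤ 0 := by
    intro Y Z ncY ncZ hYZ cY cZ
    refine Finset.sum_nonpos fun w _ => ?_
    by_cases i : w * C ∈ Y <;> by_cases j : w * C ∈ Z
    · have : w * C ∉ S₁ := fun e => by
        obtain ⟨y1, y2, z1, z2⟩ := hYZ _ i _ j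
        exact ncY.notMem_of_mem_inter ncZ (hκ.one_le _) (hκ.le_of_mem _ hC) (hκ.le_of_mem _ e)
          y1 y2 cY z1 z2 cZ i j
      simp [ι_mem i, ι_mem j, nonpos this]
    all_goals simp [ι_notMem, i, j]
  have sum11 := prod_nonpos M N (h.noncrossing_branch 1) (k.noncrossing_branch 1)
    (fun w hw w' hw' => Or.inl (and_assoc.1 ⟨h.pattern_one h₁ hκ hC hw,
      k.pattern_one h₁ hκ hC hw'⟩)) sM sN
  have sum22 := prod_nonpos M' N' (h.noncrossing_branch r₁) (k.noncrossing_branch r₁)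
    (fun w hw w' hw' => Or.inr (and_assoc.1 ⟨h.pattern_self h₁ hκ hC hw,
      k.pattern_self h₁ hκ hC hw'⟩)) sM' sN'
  have sum12 := cross_nonpos M N' (h.noncrossing_branch 1) (k.noncrossing_branch r₁)
    (fun w hw w' hw' => and_assoc.1 ⟨h.pattern_one h₁ hκ hC hw, k.pattern_self h₁ hκ hC hw'⟩)
    h.split.notMem_branch_self k.split.notMem_branch_self
  have sum21 := cross_nonpos N M' (k.noncrossing_branch 1) (h.noncrossing_branch r₁)
    (fun w hw w' hw' => and_assoc.1 ⟨k.pattern_one h₁ hκ hC hw, h.pattern_self h₁ hκ hC hw'⟩)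
    k.split.notMem_branch_self h.split.notMem_branch_self
  set X : Set U := {w | C⁻¹ * w ∈ P ∧ C⁻¹ * w ∈ Q} with hX
  have expand : ∀ w, ι X w * σ w = σ w - ι M w * σ w - ι M' w * σ w - ι N w * σ w -
      ι N' w * σ w + ι M w * ι N w * σ w + ι M' w * ι N' w * σ w + ι M w * ι N' w * σ w +
      ι N w * ι M' w * σ w := by
    intro w
    by_cases hw : w * C ∈ S₁ ↔ w ∈ S₁
    · simp [zero hw]
    have one : ∀ {P r S} (_ : Crossing P₁ r₁ S₁ κ P r S C),
        ι {w | C⁻¹ * w ∈ P} w + ι (branch P S C 1) w + ι (branch P S C r₁) w = 1 := by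
      intro P r S l
      rcases l.cover h₁ hκ hw with e | e | e
      · have e1 : w * C ∉ branch P S C 1 := fun e' => l.split.notMem_of_mem_branch e' e
        have e2 : w * C ∉ branch P S C r₁ := fun e' => l.split.notMem_of_mem_branch e' e
        rw [ι_mem (by exact e), ι_notMem e1, ι_notMem e2]; rfl
      · have e1 : w * C ∉ {w | C⁻¹ * w ∈ P} := l.split.notMem_of_mem_branch e
        rw [ι_mem e, ι_notMem e1, ι_notMem (l.disjoint_branch h₁ hκ hC e)]; rfl
      · have e1 : w * C ∉ {w | C⁻¹ * w ∈ P} := l.split.notMem_of_mem_branch e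
        rw [ι_mem e, ι_notMem e1, ι_notMem fun e' => l.disjoint_branch h₁ hκ hC e' e]; rfl
    have hXι : ι X w = ι {w | C⁻¹ * w ∈ P} w * ι {w | C⁻¹ * w ∈ Q} w := by
      by_cases i : C⁻¹ * (w * C) ∈ P <;> by_cases j : C⁻¹ * (w * C) ∈ Q <;>
        simp [hι, hX, Set.indicator, i, j]
    have o1 := eq_sub_of_add_eq (eq_sub_of_add_eq (one h))
    have o2 := eq_sub_of_add_eq (eq_sub_of_add_eq (one k))
    rw [hXι, o1, o2]
    ring
  have sX : ∑ w ∈ F, ι X w * σ w ≤ 0 := by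
    simp only [expand, Finset.sum_add_distrib, Finset.sum_sub_distrib]
    linarith
  have pos : ∀ w, 0 ≤ ι X w * σ w := by
    intro w
    by_cases i : w * C ∈ X
    · rw [ι_mem i, one_mul]
      by_contra! neg
      have n1 : w * C ∉ S₁ := fun e => absurd (nonneg e) (by omega)
      have n2 : w ∈ S₁ := by
        by_contra e
        exact absurd (zero (by simp [n1, e])) neg.ne
      have lt := h₁.wallDist_lt n2 n1
      have le := hmin _ i.1 i.2
      have eq := Splitting.wallDist_mul_left (S := S₁) w C 1
      rw [mul_one] at eq
      omega
    · simp [ι_notMem i]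
  have mem1 : (1 : U) ∈ F := by simp [hF, hC, h₁.one_notMem]
  have le := Finset.single_le_sum (fun w _ => pos w) mem1
  have e1 : ι X 1 = 1 := ι_mem (by simp [hX])
  have e2 : σ 1 = 1 := by simp [hσ, hC, h₁.one_notMem]
  rw [e1, e2] at le
  omega

/-- Helly property for cosets: three pairwise intersecting cosets have a common element. -/
theorem Splitting.exists_common {P₁ P₃ P₅ : Subgroup U} {r₁ r₃ r₅ g₁ g₃ g₅ : U}
    {S₁ S₃ S₅ : Set U} {κ : U → K} (h₁ : Splitting P₁ r₁ S₁) (hκ : Segment r₁ S₁ κ)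
    (h₃ : Splitting P₃ r₃ S₃) (n₃ : ∀ g, Noncrossing κ {w | g⁻¹ * w ∈ S₃})
    (h₅ : Splitting P₅ r₅ S₅) (n₅ : ∀ g, Noncrossing κ {w | g⁻¹ * w ∈ S₅})
    {T : Set U} (hT : Subgroup.closure T = ⊤) (hsq : ∀ t ∈ T, t * t = 1)
    (h13 : ∃ w, g₁⁻¹ * w ∈ P₁ ∧ g₃⁻¹ * w ∈ P₃) (h15 : ∃ w, g₁⁻¹ * w ∈ P₁ ∧ g₅⁻¹ * w ∈ P₅)
    (h35 : ∃ w, g₃⁻¹ * w ∈ P₃ ∧ g₅⁻¹ * w ∈ P₅) :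
    ∃ w, g₁⁻¹ * w ∈ P₁ ∧ g₃⁻¹ * w ∈ P₃ ∧ g₅⁻¹ * w ∈ P₅ := by
  obtain ⟨c, ⟨c3, c5⟩, hmin⟩ := (wellFounded_lt.onFun
    (f := fun w => Splitting.wallDist S₁ w g₁)).has_min
    {w | g₃⁻¹ * w ∈ P₃ ∧ g₅⁻¹ * w ∈ P₅} h35
  refine (h₁.exists_branch (g₁⁻¹ * c)).elim (fun e => ⟨c, e, c3, c5⟩) ?_
  rintro ⟨p, hp, hc⟩
  have conv : ∀ {g w : U} {P : Subgroup U}, g⁻¹ * c ∈ P → (g⁻¹ * w ∈ P ↔ c⁻¹ * w ∈ P) := by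
    intro g w P hg
    rw [← Subgroup.mul_mem_cancel_left (y := c⁻¹ * w) P hg, mul_assoc, mul_inv_cancel_left]
  have crossing : ∀ {g r : U} {P : Subgroup U} {S : Set U}, Splitting P r S →
      (∀ g, Noncrossing κ {w | g⁻¹ * w ∈ S}) → g⁻¹ * c ∈ P →
      (∃ w, g₁⁻¹ * w ∈ P₁ ∧ g⁻¹ * w ∈ P) →
      Crossing P₁ r₁ S₁ κ P r S (p⁻¹ * (g₁⁻¹ * c)) := by
    rintro g r P S h n hg ⟨w, w1, w2⟩
    refine ⟨h, n, p⁻¹ * (g₁⁻¹ * w), mul_mem (inv_mem hp) w1, ?_⟩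
    simpa [mul_assoc] using (conv hg).1 w2
  refine (h₁.false_of_minimal hκ hc (crossing h₃ n₃ c3 h13) (crossing h₅ n₅ c5 h15) hT hsq ?_).elim
  intro w w3 w5
  have le := hmin (g₁ * (p * w)) ⟨(conv c3).2 (by simpa [mul_assoc] using w3),
    (conv c5).2 (by simpa [mul_assoc] using w5)⟩
  have move : ∀ v, Splitting.wallDist S₁ (g₁ * (p * v)) g₁ = Splitting.wallDist S₁ v 1 := by
    intro v
    rw [← h₁.wallDist_mul_right hp _ g₁, ← mul_assoc]
    simpa using Splitting.wallDist_mul_left (S := S₁) (g₁ * p) v 1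
  have e := move (p⁻¹ * (g₁⁻¹ * c))
  simp only [mul_inv_cancel_left] at e
  simp only [Function.onFun, not_lt, move, e] at le
  exact le

end Helly

section Cyclic

variable {U K : Type*} [Group U] [LinearOrder K] [MulAction U K]

/-- The cyclic order induced by a linear order. -/
def Cyc (a b c : K) : Prop :=
  a < b ∧ b < c ∨ b < c ∧ c < a ∨ c < a ∧ a < b

/-- The action preserves the cyclic order. -/
def PreservesCyc (U K : Type*) [Group U] [LinearOrder K] [MulAction U K] : Prop :=
  ∀ (w : U) (a b c : K), Cyc a b c → Cyc (w • a) (w • b) (w • c)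

theorem PreservesCyc.noncrossing (h : PreservesCyc U K) (p α : K) (g : U) :
    Noncrossing (fun w : U => w • p) {w | g⁻¹ * w ∈ {w : U | α ≤ w • p}} := by
  intro s t u v st tu uv
  simp only [Set.mem_ofPred_eq, mul_smul] at st tu uv ⊢
  have h1 := h g⁻¹ (s • p) (t • p) (u • p)
  have h2 := h g⁻¹ (s • p) (u • p) (v • p)
  have lt : ∀ {a b : K}, a ≤ b → ¬(α ≤ g⁻¹ • a ↔ α ≤ g⁻¹ • b) → a < b := fun hab hne =>
    lt_of_le_of_ne hab fun e => hne (by rw [e])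
  constructor
  all_goals
    rintro ⟨hs, ht, hu, hv⟩
    have st' := lt st (by tauto)
    have tu' := lt tu (by tauto)
    have uv' := lt uv (by tauto)
    have h1' := h1 (Or.inl ⟨st', tu'⟩)
    have h2' := h2 (Or.inl ⟨st'.trans tu', uv'⟩)
    simp only [Cyc, not_le] at *
    grind

/-- Involutions `x 0, …, x 3` exchanging the successive points of the chain
`α 0 < α 1 < α 2 < α 3 < ∞`, the point at infinity being `p`. -/
structure IsChain (p : K) (x : Fin 4 → U) (α : Fin 4 → K) : Prop where
  bot_lt : p < α 0
  lt_one : α 0 < α 1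
  lt_two : α 1 < α 2
  lt_three : α 2 < α 3
  smul_three : x 3 • p = α 3
  smul_two : x 2 • α 3 = α 2
  smul_one : x 1 • α 2 = α 1
  smul_zero : x 0 • α 1 = α 0

/-- The half-open arcs cut out by a chain. -/
def arc (α : Fin 4 → K) : Fin 4 → Set K :=
  ![Set.Ico (α 0) (α 1), Set.Ico (α 1) (α 2), Set.Ico (α 2) (α 3), Set.Ici (α 3)]

/-- Reduced words in the letters `x i`, with their first letter. -/
inductive Reduced (x : Fin 4 → U) : Option (Fin 4) → U → Prop
  | one : Reduced x none 1
  | cons {o w} (j : Fin 4) (hj : o ≠ some j) (hw : Reduced x o w) : Reduced x (some j) (x j * w)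

theorem exists_reduced {x : Fin 4 → U} (hsq : ∀ i, x i * x i = 1)
    (hx : Subgroup.closure (Set.range x) = ⊤) (w : U) : ∃ o, Reduced x o w := by
  have step : ∀ i w, (∃ o, Reduced x o w) → ∃ o, Reduced x o (x i * w) := by
    rintro i w ⟨o, ho⟩
    by_cases e : o = some i
    · subst e
      cases ho with
      | cons _ _ hv => exact ⟨_, by rwa [← mul_assoc, hsq, one_mul]⟩
    · exact ⟨_, .cons i e ho⟩
  have hw : w ∈ Subgroup.closure (Set.range x) := hx ▸ Subgroup.mem_top w
  induction hw using Subgroup.closure_induction_left with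
  | one => exact ⟨_, .one⟩
  | mul_left y hy z _ hz =>
    obtain ⟨i, rfl⟩ := hy
    exact step i z hz
  | inv_mul_cancel y hy z _ hz =>
    obtain ⟨i, rfl⟩ := hy
    rw [inv_eq_of_mul_eq_one_left (hsq i)]
    exact step i z hz

theorem PreservesCyc.swap (h : PreservesCyc U K) {x : U} (hsq : x * x = 1) {a b t : K}
    (hab : x • a = b) (ht : Cyc b t a) : Cyc a (x • t) b := by
  have := h x b t a ht
  rwa [hab, ← hab, smul_smul, hsq, one_smul, hab] at this

namespace IsChain

variable {p : K} {x : Fin 4 → U} {α : Fin 4 → K}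

theorem smul_mem_arc (h : IsChain p x α) (hU : PreservesCyc U K) (hp : ∀ t : K, p ≤ t)
    (hsq : ∀ i, x i * x i = 1) (j : Fin 4) {t : K} (ht : t ∉ arc α j) : x j • t ∈ arc α j := by
  obtain ⟨h0, h1, h2, h3, e3, e2, e1, e0⟩ := h
  have lt : ∀ {x : U}, x * x = 1 → ∀ {a b t : K}, a < b → x • b = a → t ∉ Set.Ico a b →
      x • t ∈ Set.Ico a b := by
    intro x hx a b t hab e ht
    by_cases hb : t = b
    · subst hb; rw [e]; exact ⟨le_rfl, hab⟩
    have : Cyc b t a := by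
      simp only [Set.mem_Ico, Cyc] at ht ⊢
      grind
    have e' : x • a = b := by rw [← e, smul_smul, hx, one_smul]
    have := hU.swap hx e' this
    simp only [Set.mem_Ico, Cyc] at this ⊢
    grind
  have key : t ∉ Set.Ici (α 3) → x 3 • t ∈ Set.Ici (α 3) := by
    intro ht
    by_cases hb : t = p
    · subst hb; rw [e3]; exact le_rfl
    have hpt := lt_of_le_of_ne (hp t) (Ne.symm hb)
    simp only [Set.mem_Ici, not_le] at ht ⊢
    have e' : x 3 • α 3 = p := by rw [← e3, smul_smul, hsq, one_smul]
    have := hU.swap (hsq 3) e' (Or.inl ⟨hpt, ht⟩)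
    have := hp (x 3 • t)
    simp only [Cyc] at *
    grind
  fin_cases j
  · exact lt (hsq 0) h1 e0 ht
  · exact lt (hsq 1) h2 e1 ht
  · exact lt (hsq 2) h3 e2 ht
  · exact key ht

theorem arc_disjoint (h : IsChain p x α) {i j : Fin 4} {t : K} (hi : t ∈ arc α i)
    (hj : t ∈ arc α j) : i = j := by
  obtain ⟨h0, h1, h2, h3, -, -, -, -⟩ := h
  fin_cases i <;> fin_cases j <;> simp [arc] at hi hj ⊢ <;> grind

theorem bot_notMem_arc (h : IsChain p x α) (j : Fin 4) : p ∉ arc α j := by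
  obtain ⟨h0, h1, h2, h3, -, -, -, -⟩ := h
  fin_cases j <;> simp [arc] <;> grind

theorem smul_reduced (h : IsChain p x α) (hU : PreservesCyc U K) (hp : ∀ t : K, p ≤ t)
    (hsq : ∀ i, x i * x i = 1) {o : Option (Fin 4)} {w : U} (hw : Reduced x o w) :
    (o = none ∧ w = 1) ∨ ∃ j, o = some j ∧ w • p ∈ arc α j ∧
      ∀ m, (w * x m) • p ∈ arc α j ∨ (m = j ∧ w = x j) := by
  have into := h.smul_mem_arc hU hp hsq
  have ne : ∀ {i j t}, t ∈ arc α i → i ≠ j → t ∉ arc α j := fun hi hij hj =>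
    hij (h.arc_disjoint hi hj)
  have letter : ∀ m, x m • p ∈ arc α m := fun m => into m (h.bot_notMem_arc m)
  induction hw with
  | one => exact Or.inl ⟨rfl, rfl⟩
  | @cons o w j hj hw ih =>
    refine Or.inr ⟨j, rfl, ?_⟩
    rcases ih with ⟨rfl, rfl⟩ | ⟨i, rfl, hi, hm⟩
    · refine ⟨by simpa using letter j, fun m => ?_⟩
      by_cases e : m = j
      · exact Or.inr ⟨e, mul_one _⟩
      · left
        rw [mul_one, mul_smul]
        exact into j (ne (letter m) e)
    · have hij : i ≠ j := fun e => hj (by rw [e])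
      refine ⟨by rw [mul_smul]; exact into j (ne hi hij), fun m => Or.inl ?_⟩
      rw [mul_assoc, mul_smul]
      rcases hm m with e | ⟨rfl, rfl⟩
      · exact into j (ne e hij)
      · rw [hsq, one_smul]
        exact into j (h.bot_notMem_arc j)

theorem splitting (h : IsChain p x α) (hU : PreservesCyc U K) (hp : ∀ t : K, p ≤ t)
    (hsq : ∀ i, x i * x i = 1) (hx : Subgroup.closure (Set.range x) = ⊤) :
    Splitting (Subgroup.closure (x '' {3}ᶜ)) (x 3) {w | α 3 ≤ w • p} := by
  have hS : ∀ w : U, α 3 ≤ w • p ↔ w • p ∈ arc α 3 := fun w => Iff.rfl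
  have letter : ∀ m, x m • p ∈ arc α m := fun m =>
    h.smul_mem_arc hU hp hsq m (h.bot_notMem_arc m)
  have same : ∀ {i t}, t ∈ arc α i → (t ∈ arc α 3 ↔ i = 3) := fun hi =>
    ⟨fun h3 => h.arc_disjoint hi h3, fun e => e ▸ hi⟩
  have step : ∀ w m, (w * x m) • p ∈ arc α 3 ∧ w • p ∈ arc α 3 ∨
      (w * x m) • p ∉ arc α 3 ∧ w • p ∉ arc α 3 ∨ m = 3 ∧ (w = 1 ∨ w = x 3) := by
    intro w m
    obtain ⟨o, ho⟩ := exists_reduced hsq hx w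
    rcases h.smul_reduced hU hp hsq ho with ⟨-, rfl⟩ | ⟨j, -, hj, hm⟩
    · simp [same (letter m), h.bot_notMem_arc]
      tauto
    · rcases hm m with e | ⟨rfl, rfl⟩
      · simp only [same e, same hj]
        tauto
      · simp [same hj, hsq, h.bot_notMem_arc]
        tauto
  refine ⟨?_, ?_, hsq 3, ?_, ?_, ?_⟩
  · simpa [hS] using h.bot_notMem_arc 3
  · simp [h.smul_three]
  · intro q hq
    induction hq using Subgroup.closure_induction'' with
    | one => simp
    | mem y hy =>
      obtain ⟨m, hm, rfl⟩ := hy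
      intro w
      simp only [Set.mem_ofPred_eq, hS]
      have := step w m
      simp only [Set.mem_compl_iff, Set.mem_singleton_iff] at hm
      tauto
    | inv_mem y hy =>
      obtain ⟨m, hm, rfl⟩ := hy
      intro w
      rw [inv_eq_of_mul_eq_one_left (hsq m)]
      simp only [Set.mem_ofPred_eq, hS]
      have := step w m
      simp only [Set.mem_compl_iff, Set.mem_singleton_iff] at hm
      tauto
    | mul y z _ _ hy hz =>
      intro w
      rw [← mul_assoc, hz, hy]
  · intro w h1 h2
    simp only [Set.mem_ofPred_eq, hS]
    have := step w 3
    tauto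
  · refine top_unique (hx ▸ Subgroup.closure_le _ |>.2 ?_)
    rintro _ ⟨i, rfl⟩
    by_cases hi : i = 3
    · exact hi ▸ Subgroup.subset_closure (Set.mem_insert _ _)
    · exact Subgroup.subset_closure (Set.mem_insert_of_mem _
        (Subgroup.subset_closure ⟨i, hi, rfl⟩))

end IsChain

/-- The Hurwitz moves on quadruples of involutions. -/
def move (x : Fin 4 → U) : Fin 3 → Fin 4 → U :=
  ![![x 1, x 1 * x 0 * x 1, x 2, x 3], ![x 0, x 2, x 2 * x 1 * x 2, x 3],
    ![x 0, x 1, x 3, x 3 * x 2 * x 3]]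

/-- The inverse Hurwitz moves on quadruples of involutions. -/
def invMove (x : Fin 4 → U) : Fin 3 → Fin 4 → U :=
  ![![x 0 * x 1 * x 0, x 0, x 2, x 3], ![x 0, x 1 * x 2 * x 1, x 1, x 3],
    ![x 0, x 1, x 2 * x 3 * x 2, x 2]]

theorem IsChain.exists_move {p : K} {x : Fin 4 → U} {α : Fin 4 → K} (h : IsChain p x α)
    (hU : PreservesCyc U K) (hp : ∀ t : K, p ≤ t) (hsq : ∀ i, x i * x i = 1) (i : Fin 3) :
    (∃ β, IsChain p (move x i) β) ∧ ∃ β, IsChain p (invMove x i) β := by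
  obtain ⟨h0, h1, h2, h3, e3, e2, e1, e0⟩ := h
  have inv : ∀ {i : Fin 4} {a b : K}, x i • a = b → x i • b = a := by
    rintro i a _ rfl
    rw [smul_smul, hsq, one_smul]
  have f0 := inv e0
  have f1 := inv e1
  have f2 := inv e2
  have f3 := inv e3
  have mid : ∀ {a b t : K}, a < b → Cyc a t b → a < t ∧ t < b := by
    intro a b t hab ht
    simp only [Cyc] at ht
    grind
  obtain ⟨l1, r1⟩ := mid h2 (hU.swap (hsq 1) f1 (t := α 0) (by simp only [Cyc]; grind))
  obtain ⟨l2, r2⟩ := mid h3 (hU.swap (hsq 2) f2 (t := α 1) (by simp only [Cyc]; grind))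
  have l3 : α 3 < x 3 • α 2 := by
    have := hU.swap (hsq 3) f3 (t := α 2) (by simp only [Cyc]; grind)
    have := hp (x 3 • α 2)
    simp only [Cyc] at *
    grind
  obtain ⟨l4, r4⟩ := mid h1 (hU.swap (hsq 0) f0 (t := α 2) (by simp only [Cyc]; grind))
  obtain ⟨l5, r5⟩ := mid h2 (hU.swap (hsq 1) f1 (t := α 3) (by simp only [Cyc]; grind))
  obtain ⟨l6, r6⟩ := mid h3 (hU.swap (hsq 2) f2 (t := p) (by simp only [Cyc]; grind))
  fin_cases i
  · refine ⟨⟨![α 0, x 1 • α 0, α 2, α 3], ?_⟩, ![α 0, x 0 • α 2, α 2, α 3], ?_⟩ <;> constructor <;>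
      simp [move, invMove, mul_smul, *] <;> grind
  · refine ⟨⟨![α 0, α 1, x 2 • α 1, α 3], ?_⟩, ![α 0, α 1, x 1 • α 3, α 3], ?_⟩ <;> constructor <;>
      simp [move, invMove, mul_smul, *] <;> grind
  · refine ⟨⟨![α 0, α 1, α 2, x 3 • α 2], ?_⟩, ![α 0, α 1, α 2, x 2 • p], ?_⟩ <;> constructor <;>
      simp [move, invMove, mul_smul, *]
    grind

end Cyclic

/-- The free product of four groups of order two. -/
abbrev FourInv : Type :=
  PresentedGroup {r : FreeGroup (Fin 4) | ∃ i, r = FreeGroup.of i * FreeGroup.of i}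

namespace FourInv

/-- The standard generators of `FourInv`. -/
def letter (i : Fin 4) : FourInv := PresentedGroup.of i

@[simp]
theorem letter_mul_self (i : Fin 4) : letter i * letter i = 1 :=
  PresentedGroup.one_of_mem (x := FreeGroup.of i * FreeGroup.of i) ⟨i, rfl⟩

@[simp]
theorem letter_inv (i : Fin 4) : (letter i)⁻¹ = letter i :=
  inv_eq_of_mul_eq_one_left (letter_mul_self i)

@[simp]
theorem letter_mul_letter_mul (i : Fin 4) (w : FourInv) : letter i * (letter i * w) = w := by
  rw [← mul_assoc, letter_mul_self, one_mul]

theorem closure_range_letter : Subgroup.closure (Set.range letter) = ⊤ :=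
  PresentedGroup.closure_range_of _

section Lift

variable {G : Type*} [Group G]

/-- The homomorphism out of `FourInv` determined by four involutions. -/
def lift (x : Fin 4 → G) (hx : ∀ i, x i * x i = 1) : FourInv →* G :=
  PresentedGroup.toGroup (f := x) (by rintro _ ⟨i, rfl⟩; simpa using hx i)

@[simp]
theorem lift_letter (x : Fin 4 → G) (hx : ∀ i, x i * x i = 1) (i : Fin 4) :
    lift x hx (letter i) = x i :=
  PresentedGroup.toGroup.of _

@[ext]
theorem hom_ext {f g : FourInv →* G} (h : ∀ i, f (letter i) = g (letter i)) : f = g :=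
  PresentedGroup.ext h

end Lift

/-- The points on which `FourInv` acts, a model of the circle `ℚ / 5ℤ`. -/
abbrev Circle5 : Type := Set.Ico (0 : ℚ) 5

/-- The map exchanging the arcs `[0, 1)` and `[1, 5)`. -/
def exchangeFun (t : Circle5) : Circle5 :=
  if h : t.1 < 1 then ⟨1 + 4 * t.1, by have := t.2.1; constructor <;> linarith⟩
  else ⟨(t.1 - 1) / 4, by have := t.2.2; constructor <;> linarith⟩

/-- The rotation by one unit, as a map. -/
def rotationFun (t : Circle5) : Circle5 :=
  if h : t.1 < 4 then ⟨t.1 + 1, by have := t.2.1; constructor <;> linarith⟩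
  else ⟨t.1 - 4, by have := t.2.2; constructor <;> linarith⟩

/-- The rotation by one unit in the negative direction, as a map. -/
def rotationInvFun (t : Circle5) : Circle5 :=
  if h : t.1 < 1 then ⟨t.1 + 4, by have := t.2.1; constructor <;> linarith⟩
  else ⟨t.1 - 1, by have := t.2.2; constructor <;> linarith⟩

theorem exchangeFun_spec (t : Circle5) : t.1 < 1 ∧ (exchangeFun t).1 = 1 + 4 * t.1 ∨
    1 ≤ t.1 ∧ 4 * (exchangeFun t).1 = t.1 - 1 := by
  unfold exchangeFun
  split_ifs with h
  · exact Or.inl ⟨h, rfl⟩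
  · exact Or.inr ⟨not_lt.1 h, mul_div_cancel₀ _ (by norm_num)⟩

theorem rotationFun_spec (t : Circle5) : t.1 < 4 ∧ (rotationFun t).1 = t.1 + 1 ∨
    4 ≤ t.1 ∧ (rotationFun t).1 = t.1 - 4 := by
  unfold rotationFun
  split_ifs with h
  · exact Or.inl ⟨h, rfl⟩
  · exact Or.inr ⟨not_lt.1 h, rfl⟩

theorem rotationInvFun_spec (t : Circle5) : t.1 < 1 ∧ (rotationInvFun t).1 = t.1 + 4 ∨
    1 ≤ t.1 ∧ (rotationInvFun t).1 = t.1 - 1 := by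
  unfold rotationInvFun
  split_ifs with h
  · exact Or.inl ⟨h, rfl⟩
  · exact Or.inr ⟨not_lt.1 h, rfl⟩

theorem exchangeFun_involutive : Function.Involutive exchangeFun := fun t => by
  have h := exchangeFun_spec t
  have h' := exchangeFun_spec (exchangeFun t)
  obtain ⟨t0, t5⟩ := t.2
  refine Subtype.ext ?_
  grind

/-- The involution exchanging the arcs `[0, 1)` and `[1, 5)`. -/
def exchange : Equiv.Perm Circle5 := exchangeFun_involutive.toPerm

/-- The rotation by one unit. -/
def rotation : Equiv.Perm Circle5 where
  toFun := rotationFun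
  invFun := rotationInvFun
  left_inv t := by
    have h := rotationFun_spec t
    have h' := rotationInvFun_spec (rotationFun t)
    obtain ⟨t0, t5⟩ := t.2
    refine Subtype.ext ?_
    grind
  right_inv t := by
    have h := rotationInvFun_spec t
    have h' := rotationFun_spec (rotationInvFun t)
    obtain ⟨t0, t5⟩ := t.2
    refine Subtype.ext ?_
    grind

@[simp]
theorem exchange_apply (t : Circle5) : exchange t = exchangeFun t := rfl

@[simp]
theorem rotation_apply (t : Circle5) : rotation t = rotationFun t := rfl

@[simp]
theorem rotation_symm_apply (t : Circle5) : rotation.symm t = rotationInvFun t := rfl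

theorem cyc_rotation {a b c : Circle5} (h : Cyc a b c) :
    Cyc (rotation a) (rotation b) (rotation c) := by
  have ha := rotationFun_spec a
  have hb := rotationFun_spec b
  have hc := rotationFun_spec c
  obtain ⟨a0, a5⟩ := a.2
  obtain ⟨b0, b5⟩ := b.2
  obtain ⟨c0, c5⟩ := c.2
  simp only [rotation_apply, Cyc, ← Subtype.coe_lt_coe] at *
  grind

theorem cyc_rotation_symm {a b c : Circle5} (h : Cyc a b c) :
    Cyc (rotation.symm a) (rotation.symm b) (rotation.symm c) := by
  have ha := rotationInvFun_spec a
  have hb := rotationInvFun_spec b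
  have hc := rotationInvFun_spec c
  obtain ⟨a0, a5⟩ := a.2
  obtain ⟨b0, b5⟩ := b.2
  obtain ⟨c0, c5⟩ := c.2
  simp only [rotation_symm_apply, Cyc, ← Subtype.coe_lt_coe] at *
  grind

theorem cyc_exchange {a b c : Circle5} (h : Cyc a b c) :
    Cyc (exchange a) (exchange b) (exchange c) := by
  have ha := exchangeFun_spec a
  have hb := exchangeFun_spec b
  have hc := exchangeFun_spec c
  obtain ⟨a0, a5⟩ := a.2
  obtain ⟨b0, b5⟩ := b.2
  obtain ⟨c0, c5⟩ := c.2
  simp only [exchange_apply, Cyc, ← Subtype.coe_lt_coe] at *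
  grind

/-- The action of `FourInv` on the circle. -/
def toPerm : FourInv →* Equiv.Perm Circle5 :=
  lift (fun i => rotation ^ (i.1 + 1) * exchange * (rotation ^ (i.1 + 1))⁻¹) fun i => by
    have : exchange * exchange = 1 := Equiv.ext fun t => exchange.symm_apply_apply t
    simp [mul_assoc, ← mul_assoc exchange, this]

instance : MulAction FourInv Circle5 := MulAction.compHom Circle5 toPerm

theorem smul_def (w : FourInv) (t : Circle5) : w • t = toPerm w t := rfl

theorem preservesCyc : PreservesCyc FourInv Circle5 := by
  have pow : ∀ n : ℕ, ∀ a b c : Circle5, Cyc a b c →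
      Cyc ((rotation ^ n) a) ((rotation ^ n) b) ((rotation ^ n) c) := by
    intro n
    induction n with
    | zero => simp
    | succ n ih =>
      intro a b c h
      simpa only [pow_succ, Equiv.Perm.mul_apply] using ih _ _ _ (cyc_rotation h)
  have powInv : ∀ n : ℕ, ∀ a b c : Circle5, Cyc a b c →
      Cyc ((rotation ^ n)⁻¹ a) ((rotation ^ n)⁻¹ b) ((rotation ^ n)⁻¹ c) := by
    intro n
    induction n with
    | zero => simp
    | succ n ih =>
      intro a b c h
      rw [pow_succ', mul_inv_rev]
      exact ih _ _ _ (cyc_rotation_symm h)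
  intro w
  have hw : w ∈ Subgroup.closure (Set.range letter) := closure_range_letter ▸ Subgroup.mem_top w
  have step : ∀ i, ∀ a b c : Circle5, Cyc a b c →
      Cyc (letter i • a) (letter i • b) (letter i • c) := by
    intro i a b c h
    simp only [smul_def, toPerm, lift_letter, Equiv.Perm.mul_apply]
    exact pow _ _ _ _ (cyc_exchange (powInv _ _ _ _ h))
  induction hw using Subgroup.closure_induction'' with
  | one => simp
  | mem y hy =>
    obtain ⟨i, rfl⟩ := hy
    exact step i
  | inv_mem y hy =>
    obtain ⟨i, rfl⟩ := hy
    rw [letter_inv]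
    exact step i
  | mul y z _ _ hy hz =>
    intro a b c h
    simpa only [mul_smul] using hy _ _ _ (hz _ _ _ h)

/-- The base point of the circle. -/
def base : Circle5 := ⟨0, by norm_num⟩

theorem base_le (t : Circle5) : base ≤ t := t.2.1

theorem rotation_pow_base {k : ℕ} (hk : k < 5) : ((rotation ^ k) base).1 = k := by
  induction k with
  | zero => simp [base]
  | succ k ih =>
    have ih := ih (by omega)
    have hk' : (k : ℚ) < 4 := by exact_mod_cast (by omega : k < 4)
    have h := rotationFun_spec ((rotation ^ k) base)
    rw [ih] at h
    rw [pow_succ', Equiv.Perm.mul_apply, rotation_apply, Nat.cast_succ]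
    grind

theorem rotation_pow_five_base : (rotation ^ 5) base = base := by
  have h := rotation_pow_base (k := 4) (by norm_num)
  have h' := rotationFun_spec ((rotation ^ 4) base)
  refine Subtype.ext ?_
  rw [pow_succ', Equiv.Perm.mul_apply, rotation_apply]
  norm_num [h] at h'
  exact h'

theorem letter_smul_rotation_pow (i : Fin 4) :
    letter i • (rotation ^ (i.1 + 2)) base = (rotation ^ (i.1 + 1)) base := by
  have h : exchange (rotation base) = base := by
    have h1 : (rotation base).1 = 1 := by simpa using rotation_pow_base (k := 1) (by norm_num)
    have h2 := exchangeFun_spec (rotation base)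
    refine Subtype.ext ?_
    rw [h1, sub_self] at h2
    obtain ⟨h3, -⟩ | ⟨-, h3⟩ := h2
    · exact absurd h3 (lt_irrefl _)
    · exact (mul_eq_zero.1 h3).resolve_left (by norm_num)
  rw [smul_def, toPerm, lift_letter, Equiv.Perm.mul_apply, Equiv.Perm.mul_apply,
    pow_succ _ (i.1 + 1), Equiv.Perm.mul_apply, ← Equiv.Perm.mul_apply (_⁻¹), inv_mul_cancel, Equiv.Perm.one_apply, h]

theorem isChain_letter : IsChain base letter fun i => (rotation ^ (i.1 + 1)) base := by
  have lt : ∀ {j k : ℕ}, j < k → k < 5 → (rotation ^ j) base < (rotation ^ k) base := by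
    intro j k hj hk
    rw [← Subtype.coe_lt_coe, rotation_pow_base hk, rotation_pow_base (hj.trans hk)]
    exact_mod_cast hj
  refine ⟨lt (j := 0) (by decide) (by decide), lt (by decide) (by decide),
    lt (by decide) (by decide), lt (by decide) (by decide), ?_, letter_smul_rotation_pow 2,
    letter_smul_rotation_pow 1, letter_smul_rotation_pow 0⟩
  have h := letter_smul_rotation_pow 3
  rwa [show ((3 : Fin 4).1 + 2) = 5 from rfl, rotation_pow_five_base] at h

theorem move_sq (i : Fin 3) (j : Fin 4) : move letter i j * move letter i j = 1 := by
  fin_cases i <;> fin_cases j <;> simp [move, mul_assoc]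

theorem invMove_sq (i : Fin 3) (j : Fin 4) : invMove letter i j * invMove letter i j = 1 := by
  fin_cases i <;> fin_cases j <;> simp [invMove, mul_assoc]

/-- The automorphisms of `FourInv` given by the Hurwitz moves. -/
def hurwitz (i : Fin 3) : MulAut FourInv :=
  MonoidHom.toMulEquiv (lift (move letter i) (move_sq i)) (lift (invMove letter i) (invMove_sq i))
    (hom_ext fun j => by fin_cases i <;> fin_cases j <;> simp [move, invMove, mul_assoc])
    (hom_ext fun j => by fin_cases i <;> fin_cases j <;> simp [move, invMove, mul_assoc])

@[simp]
theorem hurwitz_letter (i : Fin 3) (j : Fin 4) : hurwitz i (letter j) = move letter i j :=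
  lift_letter _ (move_sq i) _

@[simp]
theorem hurwitz_symm_letter (i : Fin 3) (j : Fin 4) :
    (hurwitz i).symm (letter j) = invMove letter i j :=
  lift_letter _ (invMove_sq i) _

theorem mulAut_ext {φ ψ : MulAut FourInv} (h : ∀ i, φ (letter i) = ψ (letter i)) : φ = ψ :=
  MulEquiv.toMonoidHom_injective (hom_ext h)

theorem hurwitz_braid_zero :
    hurwitz 0 * hurwitz 1 * hurwitz 0 = hurwitz 1 * hurwitz 0 * hurwitz 1 :=
  mulAut_ext fun j => by fin_cases j <;> simp [move, mul_assoc]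

theorem hurwitz_braid_one :
    hurwitz 2 * hurwitz 1 * hurwitz 2 = hurwitz 1 * hurwitz 2 * hurwitz 1 :=
  mulAut_ext fun j => by fin_cases j <;> simp [move, mul_assoc]

theorem hurwitz_comm : hurwitz 0 * hurwitz 2 = hurwitz 2 * hurwitz 0 :=
  mulAut_ext fun j => by fin_cases j <;> simp [move, mul_assoc]

/-- The permutations of `FourInv` that carry the cosets of the first three letters to sets
controlled by the action on the circle. -/
def IsTame (π : Equiv.Perm FourInv) : Prop :=
  ∃ (u : FourInv) (φ : MulAut FourInv) (α : Fin 4 → Circle5),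
    IsChain base (fun i => φ (letter i)) α ∧ ∀ w, π w = u * φ w

theorem isTame_one : IsTame 1 := ⟨1, 1, _, isChain_letter, fun _ => by simp⟩

theorem IsTame.mul_mulLeft {π : Equiv.Perm FourInv} (h : IsTame π) (v : FourInv) :
    IsTame (π * Equiv.mulLeft v) := by
  obtain ⟨u, φ, α, hα, hπ⟩ := h
  exact ⟨u * φ v, φ, α, hα, fun w => by simp [hπ, mul_assoc]⟩

theorem IsTame.mul_hurwitz {π : Equiv.Perm FourInv} (h : IsTame π) (i : Fin 3) :
    IsTame (π * MulAut.toPerm FourInv (hurwitz i)) ∧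
      IsTame (π * (MulAut.toPerm FourInv (hurwitz i))⁻¹) := by
  obtain ⟨u, φ, α, hα, hπ⟩ := h
  have hsq : ∀ i, φ (letter i) * φ (letter i) = 1 := fun i => by rw [← map_mul]; simp
  obtain ⟨⟨β, hβ⟩, γ, hγ⟩ := hα.exists_move preservesCyc base_le hsq i
  refine ⟨⟨u, φ * hurwitz i, β, ?_, fun w => hπ _⟩,
    ⟨u, φ * (hurwitz i)⁻¹, γ, ?_, fun w => hπ _⟩⟩
  · convert hβ using 2 with j
    fin_cases i <;> fin_cases j <;> simp [move]
  · convert hγ using 2 with j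
    fin_cases i <;> fin_cases j <;> simp [invMove]

/-- The subgroup of `FourInv` generated by the first three letters. -/
def first : Subgroup FourInv := Subgroup.closure (letter '' {3}ᶜ)

theorem IsTame.exists_common {π₁ π₃ π₅ : Equiv.Perm FourInv} (h₁ : IsTame π₁) (h₃ : IsTame π₃)
    (h₅ : IsTame π₅) (h₁₃ : ∃ p ∈ first, ∃ q ∈ first, π₁ p = π₃ q)
    (h₁₅ : ∃ p ∈ first, ∃ q ∈ first, π₁ p = π₅ q) (h₃₅ : ∃ p ∈ first, ∃ q ∈ first, π₃ p = π₅ q) :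
    ∃ p ∈ first, ∃ q ∈ first, ∃ r ∈ first, π₁ p = π₃ q ∧ π₁ p = π₅ r := by
  obtain ⟨u₁, φ₁, α₁, c₁, e₁⟩ := h₁
  obtain ⟨u₃, φ₃, α₃, c₃, e₃⟩ := h₃
  obtain ⟨u₅, φ₅, α₅, c₅, e₅⟩ := h₅
  have split : ∀ {φ : MulAut FourInv} {α : Fin 4 → Circle5},
      IsChain base (fun i => φ (letter i)) α →
      Splitting (first.map φ.toMonoidHom) (φ (letter 3)) {w : FourInv | α 3 ≤ w • base} := by
    intro φ α h
    have := h.splitting preservesCyc base_le (fun i => by rw [← map_mul]; simp) ?_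
    · convert this using 1
      rw [first, MonoidHom.map_closure, Set.image_image]
      rfl
    · have := congrArg (Subgroup.map φ.toMonoidHom) closure_range_letter
      rwa [MonoidHom.map_closure, ← Set.range_comp,
        Subgroup.map_top_of_surjective _ φ.surjective] at this
  have mem : ∀ {u w : FourInv} {φ : MulAut FourInv}, u⁻¹ * w ∈ first.map φ.toMonoidHom ↔
      ∃ p ∈ first, u * φ p = w := by
    intro u w φ
    simp [Subgroup.mem_map, eq_inv_mul_iff_mul_eq]
  have meet : ∀ {u v : FourInv} {φ ψ : MulAut FourInv},
      (∃ p ∈ first, ∃ q ∈ first, u * φ p = v * ψ q) →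
      ∃ w, u⁻¹ * w ∈ first.map φ.toMonoidHom ∧ v⁻¹ * w ∈ first.map ψ.toMonoidHom := by
    rintro u v φ ψ ⟨p, hp, q, hq, h⟩
    exact ⟨_, mem.2 ⟨p, hp, rfl⟩, mem.2 ⟨q, hq, h.symm⟩⟩
  simp only [e₁, e₃, e₅] at h₁₃ h₁₅ h₃₅ ⊢
  have seg : Segment (φ₁ (letter 3)) {w : FourInv | α₁ 3 ≤ w • base} fun w => w • base := by
    have h3 : φ₁ (letter 3) • base = α₁ 3 := c₁.smul_three
    refine ⟨fun w => ?_, fun w hw => ?_, fun w hw => ?_⟩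
    · simpa using base_le _
    · simpa [h3] using hw
    · simpa [h3] using le_of_lt (not_le.1 hw)
  obtain ⟨w, h1, h3, h5⟩ := (split c₁).exists_common seg (split c₃)
    (fun g => preservesCyc.noncrossing base _ g) (split c₅)
    (fun g => preservesCyc.noncrossing base _ g) closure_range_letter
    (by rintro _ ⟨i, rfl⟩; simp) (meet h₁₃) (meet h₁₅) (meet h₃₅)
  obtain ⟨p, hp, rfl⟩ := mem.1 h1
  obtain ⟨q, hq, hpq⟩ := mem.1 h3
  obtain ⟨r, hr, hpr⟩ := mem.1 h5
  exact ⟨p, hp, q, hq, r, hr, hpq.symm, hpr.symm⟩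

end FourInv

open Gen FourInv

section Relations

theorem gen_braid (s : Gen) (hs : s ≠ d) : gen s * gen d * gen s = gen d * gen s * gen d := by
  have h := PresentedGroup.one_of_mem (rels := Rels) ⟨s, d, hs, Or.inl ⟨Or.inr rfl, rfl⟩⟩
  simp only [map_mul, map_inv] at h
  exact mul_inv_eq_one.1 h

theorem gen_comm (s t : Gen) (hs : s ≠ d) (ht : t ≠ d) : gen s * gen t = gen t * gen s := by
  rcases eq_or_ne s t with rfl | hst
  · rfl
  have h := PresentedGroup.one_of_mem (rels := Rels) ⟨s, t, hst, Or.inr ⟨⟨hs, ht⟩, rfl⟩⟩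
  simp only [map_mul, map_inv] at h
  exact mul_inv_eq_iff_eq_mul.1 (mul_inv_eq_one.1 h)

/-- The homomorphism out of the Artin group determined by a solution of its relations. -/
def artinLift {G : Type*} [Group G] (f : Gen → G)
    (hbraid : ∀ s, s ≠ d → f s * f d * f s = f d * f s * f d)
    (hcomm : ∀ s t, s ≠ d → t ≠ d → f s * f t = f t * f s) : Artin →* G :=
  PresentedGroup.toGroup (f := f) (rels := Rels) (by
    rintro _ ⟨s, t, hst, ⟨rfl | rfl, rfl⟩ | ⟨⟨hs, ht⟩, rfl⟩⟩
    · simpa only [map_mul, map_inv, FreeGroup.lift_apply_of, mul_inv_eq_one] using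
        (hbraid t hst.symm).symm
    · simpa only [map_mul, map_inv, FreeGroup.lift_apply_of, mul_inv_eq_one] using hbraid s hst
    · simpa only [map_mul, map_inv, FreeGroup.lift_apply_of, mul_inv_eq_one,
        mul_inv_eq_iff_eq_mul, one_mul] using hcomm s t hs ht)

@[simp]
theorem artinLift_gen {G : Type*} [Group G] (f : Gen → G) (hbraid hcomm) (s : Gen) :
    artinLift f hbraid hcomm (gen s) = f s :=
  PresentedGroup.toGroup.of _

theorem closure_range_gen : Subgroup.closure (Set.range gen) = ⊤ :=
  PresentedGroup.closure_range_of _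

theorem artin_induction {p : Artin → Prop} (one : p 1) (mul : ∀ g s, p g → p (g * gen s))
    (mul_inv : ∀ g s, p g → p (g * (gen s)⁻¹)) (g : Artin) : p g := by
  have hg : g ∈ Subgroup.closure (Set.range gen) := closure_range_gen ▸ Subgroup.mem_top g
  induction hg using Subgroup.closure_induction_right with
  | one => exact one
  | mul_right x hx y hy ih =>
    obtain ⟨s, rfl⟩ := hy
    exact mul _ _ ih
  | mul_inv_cancel x hx y hy ih =>
    obtain ⟨s, rfl⟩ := hy
    exact mul_inv _ _ ih

theorem gen_mem_Ahat {s t : Gen} (h : t ≠ s) : gen t ∈ Ahat s :=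
  Subgroup.subset_closure ⟨t, h, rfl⟩

end Relations

section Swap

/-- The transposition of the generators `a` and `b`. -/
def swapGen : Gen → Gen
  | a => b
  | b => a
  | c => c
  | d => d

theorem swapGen_ne_d {s : Gen} (h : s ≠ d) : swapGen s ≠ d := by
  cases s <;> simp_all [swapGen]

theorem gen_swapGen_braid (s : Gen) (hs : s ≠ d) :
    gen (swapGen s) * gen (swapGen d) * gen (swapGen s) =
      gen (swapGen d) * gen (swapGen s) * gen (swapGen d) :=
  gen_braid _ (swapGen_ne_d hs)

/-- The diagram automorphism exchanging `a` and `b`, as a homomorphism. -/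
def swapHom : Artin →* Artin :=
  artinLift (fun s => gen (swapGen s)) gen_swapGen_braid
    fun _ _ hs ht => gen_comm _ _ (swapGen_ne_d hs) (swapGen_ne_d ht)

theorem swapHom_comp : swapHom.comp swapHom = MonoidHom.id Artin :=
  PresentedGroup.ext fun s => by
    change swapHom (swapHom (gen s)) = gen s
    cases s <;> simp [swapHom, swapGen]

/-- The diagram automorphism exchanging `a` and `b`. -/
def swap : MulAut Artin := MonoidHom.toMulEquiv swapHom swapHom swapHom_comp swapHom_comp

theorem swap_gen (s : Gen) : swap (gen s) = gen (swapGen s) := by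
  change swapHom (gen s) = gen (swapGen s)
  rw [swapHom, artinLift_gen]

theorem swap_mul_swap : swap * swap = 1 := MulEquiv.ext fun g => DFunLike.congr_fun swapHom_comp g

theorem swap_mem_Ahat {s : Gen} {g : Artin} (hg : g ∈ Ahat s) : swap g ∈ Ahat (swapGen s) := by
  have : Ahat s ≤ (Ahat (swapGen s)).comap swap.toMonoidHom := by
    rw [Ahat, Subgroup.closure_le]
    rintro _ ⟨t, ht, rfl⟩
    change swap (gen t) ∈ Ahat (swapGen s)
    rw [swap_gen]
    refine gen_mem_Ahat ?_
    revert ht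
    cases s <;> cases t <;> simp [swapGen]
  exact this hg

end Swap

section Action

/-- Left translation by the first letter. -/
def shift : Equiv.Perm FourInv := Equiv.mulLeft (letter 0)

theorem shift_mul_shift : shift * shift = 1 := Equiv.ext fun w => letter_mul_letter_mul 0 w

/-- The Hurwitz moves as permutations. -/
def hurwitzPerm (i : Fin 3) : Equiv.Perm FourInv := MulAut.toPerm FourInv (hurwitz i)

theorem hurwitzPerm_apply (i : Fin 3) (w : FourInv) : hurwitzPerm i w = hurwitz i w := rfl

theorem shift_hurwitz (i : Fin 3) (hi : i ≠ 0) :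
    shift * hurwitzPerm i = hurwitzPerm i * shift := by
  ext w
  have h : hurwitz i (letter 0) = letter 0 := by
    fin_cases i
    · exact absurd rfl hi
    all_goals simp [move]
  simp [shift, hurwitzPerm_apply, h]

/-- The permutations of `FourInv` by which the generators act. -/
def actGen : Gen → Equiv.Perm FourInv
  | a => shift * hurwitzPerm 0 * shift
  | b => hurwitzPerm 0
  | c => hurwitzPerm 2
  | d => hurwitzPerm 1

theorem actGen_swap (s : Gen) : actGen (swapGen s) = shift * actGen s * shift := by
  have h := shift_mul_shift
  cases s
  · simp [actGen, swapGen, mul_assoc, h, ← mul_assoc shift shift]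
  · rfl
  · rw [swapGen, actGen, shift_hurwitz _ (by decide), mul_assoc, h, mul_one]
  · rw [swapGen, actGen, shift_hurwitz _ (by decide), mul_assoc, h, mul_one]

theorem actGen_braid (s : Gen) (hs : s ≠ d) :
    actGen s * actGen d * actGen s = actGen d * actGen s * actGen d := by
  have hb : actGen b * actGen d * actGen b = actGen d * actGen b * actGen d := by
    simpa only [map_mul] using! congrArg (MulAut.toPerm FourInv) hurwitz_braid_zero
  cases s
  · have ha : actGen a = shift * actGen b * shift := rfl
    have hd : actGen d = shift * actGen d * shift := actGen_swap d
    have key := congrArg (fun π => shift * π * shift) hb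
    have conj : ∀ x y z : Equiv.Perm FourInv, (shift * x * shift) * (shift * y * shift) *
        (shift * z * shift) = shift * (x * y * z) * shift := by
      intro x y z
      simp only [mul_assoc, ← mul_assoc shift shift, shift_mul_shift, one_mul]
    rw [ha, hd, conj, conj]
    exact key
  · exact hb
  · simpa only [map_mul] using! congrArg (MulAut.toPerm FourInv) hurwitz_braid_one
  · exact absurd rfl hs

theorem actGen_comm_ab : actGen a * actGen b = actGen b * actGen a := by
  ext w
  simp [actGen, shift, hurwitzPerm_apply, move, mul_assoc]

theorem actGen_comm_bc : actGen b * actGen c = actGen c * actGen b := by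
  simpa only [map_mul] using! congrArg (MulAut.toPerm FourInv) hurwitz_comm

theorem actGen_comm_ac : actGen a * actGen c = actGen c * actGen a := by
  have h := shift_hurwitz 2 (by decide)
  have h' : hurwitzPerm 0 * hurwitzPerm 2 = hurwitzPerm 2 * hurwitzPerm 0 := actGen_comm_bc
  simp only [actGen]
  rw [mul_assoc, h, ← mul_assoc, mul_assoc shift, h', ← mul_assoc, h]
  simp only [mul_assoc]

theorem actGen_comm (s t : Gen) (hs : s ≠ d) (ht : t ≠ d) :
    actGen s * actGen t = actGen t * actGen s := by
  have hab := actGen_comm_ab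
  have hbc := actGen_comm_bc
  have hac := actGen_comm_ac
  cases s <;> cases t <;> first | rfl | contradiction | assumption | (symm; assumption)

/-- The action of the Artin group on `FourInv`. -/
def act : Artin →* Equiv.Perm FourInv := artinLift actGen actGen_braid actGen_comm

@[simp]
theorem act_gen (s : Gen) : act (gen s) = actGen s := artinLift_gen _ _ _ _

theorem act_swap (g : Artin) : act (swap g) = shift * act g * shift := by
  induction g using artin_induction with
  | one => simp [shift_mul_shift]
  | mul g s ih =>
    rw [map_mul, map_mul, ih, swap_gen, act_gen, actGen_swap, map_mul, act_gen]
    simp only [mul_assoc, ← mul_assoc shift shift, shift_mul_shift, one_mul]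
  | mul_inv g s ih =>
    have h : (shift * actGen s * shift)⁻¹ = shift * (actGen s)⁻¹ * shift := by
      rw [mul_inv_rev, mul_inv_rev, inv_eq_of_mul_eq_one_left shift_mul_shift, mul_assoc]
    rw [map_mul, map_mul, map_inv, map_inv, ih, swap_gen, act_gen, actGen_swap, map_mul, map_inv,
      act_gen, h]
    simp only [mul_assoc, ← mul_assoc shift shift, shift_mul_shift, one_mul]

theorem isTame_act (g : Artin) : IsTame (act g) := by
  induction g using artin_induction with
  | one => simpa using isTame_one
  | mul g s ih =>
    rw [map_mul, act_gen]
    cases s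
    · exact ((ih.mul_mulLeft (letter 0)).mul_hurwitz 0).1.mul_mulLeft (letter 0)
    · exact (ih.mul_hurwitz 0).1
    · exact (ih.mul_hurwitz 2).1
    · exact (ih.mul_hurwitz 1).1
  | mul_inv g s ih =>
    rw [map_mul, map_inv, act_gen]
    cases s
    · have h : (actGen a)⁻¹ = shift * (hurwitzPerm 0)⁻¹ * shift := by
        rw [actGen, mul_inv_rev, mul_inv_rev, inv_eq_of_mul_eq_one_left shift_mul_shift, mul_assoc]
      rw [h]
      exact ((ih.mul_mulLeft (letter 0)).mul_hurwitz 0).2.mul_mulLeft (letter 0)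
    · exact (ih.mul_hurwitz 0).2
    · exact (ih.mul_hurwitz 2).2
    · exact (ih.mul_hurwitz 1).2

theorem act_one_of_mem {g : Artin} (hg : g ∈ Ahat a) : act g 1 = 1 := by
  have : Ahat a ≤ (MulAction.stabilizer (Equiv.Perm FourInv) (1 : FourInv)).comap act := by
    rw [Ahat, Subgroup.closure_le]
    rintro _ ⟨t, ht, rfl⟩
    change act (gen t) 1 = 1
    cases t
    · contradiction
    all_goals simp [actGen, hurwitzPerm_apply]
  exact this hg

theorem letter_mem_first {i : Fin 4} (hi : i ≠ 3) : letter i ∈ first :=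
  Subgroup.subset_closure ⟨i, hi, rfl⟩

theorem hurwitz_mem_first {i : Fin 3} (hi : i ≠ 2) (w : FourInv) :
    hurwitz i w ∈ first ↔ w ∈ first := by
  have h0 := letter_mem_first (i := 0) (by decide)
  have h1 := letter_mem_first (i := 1) (by decide)
  have h2 := letter_mem_first (i := 2) (by decide)
  have fwd : first ≤ first.comap (hurwitz i).toMonoidHom := by
    conv_lhs => rw [first]
    rw [Subgroup.closure_le]
    rintro _ ⟨j, hj, rfl⟩
    change hurwitz i (letter j) ∈ first
    fin_cases i <;> fin_cases j <;> simp_all [move, mul_mem]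
  have bwd : first ≤ first.comap (hurwitz i).symm.toMonoidHom := by
    conv_lhs => rw [first]
    rw [Subgroup.closure_le]
    rintro _ ⟨j, hj, rfl⟩
    change (hurwitz i).symm (letter j) ∈ first
    fin_cases i <;> fin_cases j <;> simp_all [invMove, mul_mem]
  exact ⟨fun h => by simpa using bwd h, fun h => fwd h⟩

theorem act_mem_first {g : Artin} (hg : g ∈ Ahat c) (w : FourInv) :
    act g w ∈ first ↔ w ∈ first := by
  have h0 : ∀ w, letter 0 * w ∈ first ↔ w ∈ first := fun w =>
    first.mul_mem_cancel_left (letter_mem_first (by decide))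
  have hgen : ∀ s, s ≠ c → ∀ w, act (gen s) w ∈ first ↔ w ∈ first := by
    intro s hs w
    cases s
    · simp [actGen, shift, hurwitzPerm_apply, h0, hurwitz_mem_first, - map_mul]
    · simp [actGen, hurwitzPerm_apply, hurwitz_mem_first]
    · contradiction
    · simp [actGen, hurwitzPerm_apply, hurwitz_mem_first]
  induction hg using Subgroup.closure_induction generalizing w with
  | mem x hx =>
    obtain ⟨s, hs, rfl⟩ := hx
    exact hgen s hs w
  | one => simp
  | mul x y _ _ hx hy =>
    rw [map_mul, Equiv.Perm.mul_apply]
    exact (hx _).trans (hy w)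
  | inv x _ hx =>
    refine (hx _).symm.trans ?_
    rw [← Equiv.Perm.mul_apply, ← map_mul, mul_inv_cancel, map_one, Equiv.Perm.one_apply]

/-- Every element of `first` lies in the orbit of `1` or of the first letter. -/
theorem exists_act_eq {p : FourInv} (hp : p ∈ first) :
    ∃ u ∈ Ahat c, act u 1 = p ∨ act u (letter 0) = p := by
  let O : Set FourInv := {p | ∃ u ∈ Ahat c, act u 1 = p ∨ act u (letter 0) = p}
  have hact : ∀ g ∈ Ahat c, ∀ w ∈ O, act g w ∈ O := by
    rintro g hg _ ⟨u, hu, rfl | rfl⟩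
    · exact ⟨g * u, mul_mem hg hu, Or.inl (by simp)⟩
    · exact ⟨g * u, mul_mem hg hu, Or.inr (by simp)⟩
  have hswap : ∀ u ∈ Ahat c, swap u ∈ Ahat c := fun u hu => by
    have h := swap_mem_Ahat hu
    rwa [swapGen] at h
  have h0 : ∀ w ∈ O, letter 0 * w ∈ O := by
    rintro _ ⟨u, hu, rfl | rfl⟩
    · exact ⟨swap u, hswap u hu, Or.inr (by simp [act_swap, shift])⟩
    · exact ⟨swap u, hswap u hu, Or.inl (by simp [act_swap, shift])⟩
  have hnext : ∀ (g : Artin) (i : Fin 3) (x y : FourInv), g ∈ Ahat c → act g = hurwitzPerm i →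
      hurwitz i x = y → (∀ w ∈ O, x * w ∈ O) → ∀ w ∈ O, y * w ∈ O := by
    rintro g i x _ hg hgi rfl hx w hw
    have := hact g hg _ (hx _ (hact g⁻¹ (inv_mem hg) w hw))
    have e : act g (act g⁻¹ w) = w := by
      rw [← Equiv.Perm.mul_apply, ← map_mul, mul_inv_cancel, map_one, Equiv.Perm.one_apply]
    rw [hgi] at this e
    rwa [hurwitzPerm_apply, map_mul, ← hurwitzPerm_apply _ (act _ _), e] at this
  have h1 := hnext (gen b) 0 (letter 0) (letter 1) (gen_mem_Ahat (by decide)) (act_gen b)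
    (by simp [move]) h0
  have h2 := hnext (gen d) 1 (letter 1) (letter 2) (gen_mem_Ahat (by decide)) (act_gen d)
    (by simp [move]) h1
  have hmul : ∀ x ∈ letter '' {3}ᶜ, ∀ w ∈ O, x * w ∈ O := by
    rintro _ ⟨j, hj, rfl⟩
    fin_cases j
    · exact h0
    · exact h1
    · exact h2
    · exact absurd rfl hj
  change p ∈ O
  induction hp using Subgroup.closure_induction_left with
  | one => exact ⟨1, one_mem _, Or.inl (by simp)⟩
  | mul_left x hx y _ ih => exact hmul x hx y ih
  | inv_mul_cancel x hx y _ ih =>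
    obtain ⟨j, hj, rfl⟩ := hx
    rw [letter_inv]
    exact hmul _ ⟨j, hj, rfl⟩ y ih

/-- The parity of the word length on `FourInv`. -/
def parity : FourInv →* ℤˣ := lift (fun _ => -1) (by simp)

theorem parity_hurwitz (i : Fin 3) (w : FourInv) : parity (hurwitz i w) = parity w := by
  have : parity.comp (hurwitz i).toMonoidHom = parity := hom_ext fun j => by
    change parity (hurwitz i (letter j)) = _
    fin_cases i <;> fin_cases j <;> simp [move, parity]
  exact DFunLike.congr_fun this w

theorem parity_act (g : Artin) (w : FourInv) : parity (act g w) = parity w := by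
  have hgen : ∀ s w, parity (actGen s w) = parity w := by
    intro s w
    cases s
    · have h0 : ∀ w, parity (letter 0 * w) = - parity w := fun w => by simp [parity]
      simp only [actGen, shift, Equiv.Perm.mul_apply, Equiv.coe_mulLeft, h0, hurwitzPerm_apply,
        parity_hurwitz, neg_neg]
    all_goals simp only [actGen, hurwitzPerm_apply, parity_hurwitz]
  induction g using artin_induction generalizing w with
  | one => simp
  | mul g s ih => rw [map_mul, Equiv.Perm.mul_apply, ih, act_gen, hgen]
  | mul_inv g s ih =>
    rw [map_mul, Equiv.Perm.mul_apply, ih, ← hgen s, ← act_gen, ← Equiv.Perm.mul_apply, ← map_mul,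
      mul_inv_cancel, map_one, Equiv.Perm.one_apply]

end Action

section Holomorph

/-- The holomorph of the Artin group. -/
abbrev Hol : Type := Artin ⋊[MonoidHom.id (MulAut Artin)] MulAut Artin

/-- The generators of the Artin group as elements of its holomorph. -/
def holGen (s : Gen) : Hol := SemidirectProduct.inl (gen s)

/-- The diagram automorphism as an element of the holomorph. -/
def flip : Hol := SemidirectProduct.inr swap

theorem flip_mul_flip : flip * flip = 1 := by
  rw [flip, ← map_mul, swap_mul_swap, map_one]

theorem flip_inl (g : Artin) :
    flip * SemidirectProduct.inl g = SemidirectProduct.inl (swap g) * flip := by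
  have h := SemidirectProduct.inl_aut (φ := MonoidHom.id (MulAut Artin)) swap g
  rw [map_inv] at h
  exact (eq_mul_inv_iff_mul_eq.1 h).symm

theorem semiconj_flip (s : Gen) : SemiconjBy flip (holGen s) (holGen (swapGen s)) := by
  rw [holGen, holGen, ← swap_gen]
  exact flip_inl (gen s)

theorem holGen_braid (s : Gen) (hs : s ≠ d) :
    holGen s * holGen d * holGen s = holGen d * holGen s * holGen d := by
  simp only [holGen, ← map_mul, gen_braid s hs]

theorem holGen_comm (s t : Gen) (hs : s ≠ d) (ht : t ≠ d) :
    holGen s * holGen t = holGen t * holGen s := by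
  simp only [holGen, ← map_mul, gen_comm s t hs ht]

/-- The involutions of the holomorph that correspond to the letters of `FourInv`. -/
def invol : Fin 4 → Hol :=
  ![flip, holGen b * flip * (holGen b)⁻¹,
    holGen d * (holGen b * flip * (holGen b)⁻¹) * (holGen d)⁻¹,
    holGen c * (holGen d * (holGen b * flip * (holGen b)⁻¹) * (holGen d)⁻¹) * (holGen c)⁻¹]

theorem invol_sq (i : Fin 4) : invol i * invol i = 1 := by
  have h : ∀ {t : Hol} (g : Hol), t * t = 1 → g * t * g⁻¹ * (g * t * g⁻¹) = 1 := by
    intro t g ht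
    rw [conj_mul, ht, mul_one, mul_inv_cancel]
  fin_cases i
  · exact flip_mul_flip
  · exact h _ flip_mul_flip
  · exact h _ (h _ flip_mul_flip)
  · exact h _ (h _ (h _ flip_mul_flip))

theorem _root_.SemiconjBy.of_mul_left {G : Type*} [Group G] {g h x y z : G} (hx : SemiconjBy g x y)
    (hz : SemiconjBy (h * g) x z) : SemiconjBy h y z := by
  have := hz.mul_left hx.inv_symm_left
  rwa [mul_inv_cancel_right] at this

theorem _root_.SemiconjBy.hurwitz_transport {G : Type*} [Group G] {f f' g x y x' y' : G}
    (h : SemiconjBy f x (x * y * x)) (hf : g * f = f' * g) (hx : SemiconjBy g x x')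
    (hy : SemiconjBy g y y') : SemiconjBy f' x' (x' * y' * x') :=
  SemiconjBy.of_mul_left hx (hf ▸ ((hx.mul_right hy).mul_right hx).mul_left h)

theorem semiconj_invol (i : Fin 3) (j : Fin 4) :
    SemiconjBy (![holGen b, holGen d, holGen c] i) (invol j) (move invol i j) := by
  have conj : ∀ g t : Hol, SemiconjBy g t (g * t * g⁻¹) := fun g t => by
    rw [SemiconjBy, inv_mul_cancel_right]
  have b0 : SemiconjBy (holGen b) (invol 0) (invol 1) := conj _ _
  have d1 : SemiconjBy (holGen d) (invol 1) (invol 2) := conj _ _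
  have c2 : SemiconjBy (holGen c) (invol 2) (invol 3) := conj _ _
  have d0 : SemiconjBy (holGen d) (invol 0) (invol 0) := (semiconj_flip d).symm
  have c0 : SemiconjBy (holGen c) (invol 0) (invol 0) := (semiconj_flip c).symm
  have bc := holGen_comm b c (by decide) (by decide)
  have bd := holGen_braid b (by decide)
  have cd := holGen_braid c (by decide)
  have c1 : SemiconjBy (holGen c) (invol 1) (invol 1) :=
    SemiconjBy.of_mul_left b0 (bc ▸ b0.mul_left c0)
  have b2 : SemiconjBy (holGen b) (invol 2) (invol 2) := by
    refine SemiconjBy.of_mul_left (d1.mul_left b0) ?_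
    rw [← mul_assoc, bd]
    exact (d1.mul_left b0).mul_left d0
  have b3 : SemiconjBy (holGen b) (invol 3) (invol 3) :=
    SemiconjBy.of_mul_left c2 (bc ▸ c2.mul_left b2)
  have d3 : SemiconjBy (holGen d) (invol 3) (invol 3) := by
    refine SemiconjBy.of_mul_left (c2.mul_left d1) ?_
    rw [← mul_assoc, ← cd]
    exact (c2.mul_left d1).mul_left c1
  have b1 : SemiconjBy (holGen b) (invol 1) (invol 1 * invol 0 * invol 1) := by
    have ha : flip * (holGen b)⁻¹ = (holGen a)⁻¹ * flip := (semiconj_flip b).inv_right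
    have hab : (holGen a)⁻¹ * holGen b = holGen b * (holGen a)⁻¹ :=
      (Commute.inv_right (holGen_comm b a (by decide) (by decide))).eq.symm
    change holGen b * (holGen b * flip * (holGen b)⁻¹) =
      holGen b * flip * (holGen b)⁻¹ * flip * (holGen b * flip * (holGen b)⁻¹) * holGen b
    calc
      _ = holGen b * (holGen b * (holGen a)⁻¹) * flip := by rw [mul_assoc _ flip, ha]; group
      _ = holGen b * (flip * (holGen b)⁻¹) * flip * holGen b * flip := by
        rw [← hab, ha]
        simp only [mul_assoc, flip_mul_flip, one_mul]
      _ = _ := by group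
  have d2 : SemiconjBy (holGen d) (invol 2) (invol 2 * invol 1 * invol 2) :=
    b1.hurwitz_transport (by rw [bd, mul_assoc]) (b2.mul_left d1) (b0.mul_left d0)
  have c3 : SemiconjBy (holGen c) (invol 3) (invol 3 * invol 2 * invol 3) :=
    d2.hurwitz_transport (by rw [← cd, mul_assoc]) (d3.mul_left c2) (d1.mul_left c1)
  fin_cases i <;> fin_cases j <;> simp [move] <;> assumption

/-- The homomorphism from `FourInv` to the holomorph. -/
def toHol : FourInv →* Hol := lift invol invol_sq

theorem semiconj_toHol (i : Fin 3) (w : FourInv) :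
    SemiconjBy (![holGen b, holGen d, holGen c] i) (toHol w) (toHol (hurwitz i w)) := by
  have : (MulAut.conj (![holGen b, holGen d, holGen c] i)).toMonoidHom.comp toHol =
      toHol.comp (hurwitz i).toMonoidHom := by
    refine hom_ext fun j => ?_
    change (![holGen b, holGen d, holGen c] i) * toHol (letter j) * _⁻¹ =
      toHol (hurwitz i (letter j))
    rw [mul_inv_eq_iff_eq_mul, hurwitz_letter]
    have h : toHol (move letter i j) = move invol i j := by
      fin_cases i <;> fin_cases j <;> simp [move, toHol]
    rw [h, toHol, lift_letter]
    exact semiconj_invol i j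
  exact mul_inv_eq_iff_eq_mul.1 (DFunLike.congr_fun this w)

theorem exists_toHol_act (g : Artin) (w : FourInv) : ∃ h ∈ Ahat a,
    SemidirectProduct.inl g * toHol w = toHol (act g w) * SemidirectProduct.inl h := by
  have hgen : ∀ s w, ∃ h ∈ Ahat a,
      holGen s * toHol w = toHol (actGen s w) * SemidirectProduct.inl h := by
    intro s w
    cases s
    · refine ⟨gen b, gen_mem_Ahat (by decide), ?_⟩
      have h0 : toHol (letter 0) = flip := lift_letter _ _ _
      have h1 : holGen a = flip * holGen b * flip := by
        rw [(semiconj_flip b).eq, mul_assoc, flip_mul_flip, mul_one]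
        rfl
      have h2 : SemiconjBy (holGen b) _ _ := semiconj_toHol 0 (letter 0 * w)
      change _ = toHol (letter 0 * hurwitz 0 (letter 0 * w)) * holGen b
      rw [map_mul, mul_assoc, ← h2.eq, map_mul, h0, h1]
      simp only [mul_assoc]
    · exact ⟨gen b, gen_mem_Ahat (by decide), semiconj_toHol 0 w⟩
    · exact ⟨gen c, gen_mem_Ahat (by decide), semiconj_toHol 2 w⟩
    · exact ⟨gen d, gen_mem_Ahat (by decide), semiconj_toHol 1 w⟩
  induction g using artin_induction generalizing w with
  | one => exact ⟨1, one_mem _, by simp⟩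
  | mul g s ih =>
    obtain ⟨h, hh, e⟩ := hgen s w
    obtain ⟨k, hk, e'⟩ := ih (actGen s w)
    refine ⟨k * h, mul_mem hk hh, ?_⟩
    rw [map_mul, mul_assoc, ← holGen, e, ← mul_assoc, e', mul_assoc, ← map_mul, map_mul act,
      act_gen]
    rfl
  | mul_inv g s ih =>
    obtain ⟨h, hh, e⟩ := hgen s ((actGen s)⁻¹ w)
    obtain ⟨k, hk, e'⟩ := ih ((actGen s)⁻¹ w)
    refine ⟨k * h⁻¹, mul_mem hk (inv_mem hh), ?_⟩
    have e1 : actGen s ((actGen s)⁻¹ w) = w := by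
      rw [← Equiv.Perm.mul_apply, mul_inv_cancel, Equiv.Perm.one_apply]
    rw [e1] at e
    rw [map_mul, map_inv, mul_assoc, ← holGen, eq_mul_inv_of_mul_eq e.symm]
    simp only [← mul_assoc]
    rw [inv_mul_cancel_right, e', map_mul act, map_inv act, act_gen, map_mul, map_inv]
    simp only [mul_assoc]
    rfl

theorem mem_Ahat_a_of_act {g : Artin} (hg : act g 1 = 1) : g ∈ Ahat a := by
  obtain ⟨h, hh, e⟩ := exists_toHol_act g 1
  rw [hg, map_one, mul_one, one_mul] at e
  rwa [SemidirectProduct.inl_injective e]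

theorem mem_Ahat_b_of_act {g : Artin} (hg : act g (letter 0) = letter 0) : g ∈ Ahat b := by
  obtain ⟨h, hh, e⟩ := exists_toHol_act g (letter 0)
  have h0 : toHol (letter 0) = flip := lift_letter _ _ _
  rw [hg, h0, flip_inl] at e
  rw [SemidirectProduct.inl_injective (mul_right_cancel e)]
  have h1 := swap_mem_Ahat hh
  rwa [swapGen] at h1

end Holomorph

section Cosets

theorem mem_smul_iff {g k : Artin} {H : Subgroup Artin} :
    k ∈ g • (H : Set Artin) ↔ g⁻¹ * k ∈ H := by
  rw [Set.mem_smul_set_iff_inv_smul_mem, smul_eq_mul, SetLike.mem_coe]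

theorem exists_act_eq_act {g g' k : Artin}
    (h : (g • (Ahat c : Set Artin) ∩ k • (Ahat a : Set Artin)).Nonempty)
    (h' : (g' • (Ahat c : Set Artin) ∩ k • (Ahat a : Set Artin)).Nonempty) :
    ∃ p ∈ first, ∃ q ∈ first, act g p = act g' q := by
  have key : ∀ {g : Artin}, (g • (Ahat c : Set Artin) ∩ k • (Ahat a : Set Artin)).Nonempty →
      ∃ p ∈ first, act g p = act k 1 := by
    rintro g ⟨v, hv, hv'⟩
    refine ⟨act (g⁻¹ * v) 1, (act_mem_first (mem_smul_iff.1 hv) 1).2 (one_mem _), ?_⟩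
    rw [← Equiv.Perm.mul_apply, ← map_mul, mul_inv_cancel_left]
    conv_rhs => rw [← act_one_of_mem (mem_smul_iff.1 hv'), ← Equiv.Perm.mul_apply, ← map_mul,
      mul_inv_cancel_left]
  obtain ⟨p, hp, e⟩ := key h
  obtain ⟨q, hq, e'⟩ := key h'
  exact ⟨p, hp, q, hq, e.trans e'.symm⟩

theorem exists_coset {g₁ g₃ g₅ : Artin} {p q r : FourInv} (hp : p ∈ first) (hq : q ∈ first)
    (hr : r ∈ first) (h₃ : act g₁ p = act g₃ q) (h₅ : act g₁ p = act g₅ r) :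
    ∃ z : Set Artin, (IsCosetOf z (Ahat a) ∨ IsCosetOf z (Ahat b)) ∧
      (z ∩ g₁ • (Ahat c : Set Artin)).Nonempty ∧ (z ∩ g₃ • (Ahat c : Set Artin)).Nonempty ∧
      (z ∩ g₅ • (Ahat c : Set Artin)).Nonempty := by
  have lift : ∀ g, ∀ p ∈ first, ∃ v ∈ g • (Ahat c : Set Artin),
      act v 1 = act g p ∨ act v (letter 0) = act g p := by
    intro g p hp
    obtain ⟨u, hu, h⟩ := exists_act_eq hp
    refine ⟨g * u, mem_smul_iff.2 (by simpa using hu), h.imp ?_ ?_⟩ <;>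
    · rintro rfl
      rw [map_mul, Equiv.Perm.mul_apply]
  obtain ⟨v₁, m₁, e₁⟩ := lift g₁ p hp
  obtain ⟨v₃, m₃, e₃⟩ := lift g₃ q hq
  obtain ⟨v₅, m₅, e₅⟩ := lift g₅ r hr
  rw [← h₃] at e₃
  rw [← h₅] at e₅
  generalize act g₁ p = w at *
  have even : ∀ {v : Artin}, act v 1 = w → parity w = 1 := by
    rintro v rfl
    rw [parity_act, map_one]
  have odd : ∀ {v : Artin}, act v (letter 0) = w → parity w = -1 := by
    rintro v rfl
    rw [parity_act, parity, lift_letter]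
  have ne : (1 : ℤˣ) ≠ -1 := by decide
  have mem : ∀ {v v' : Artin} {y : FourInv}, act v y = w → act v' y = w →
      act (v⁻¹ * v') y = y := by
    intro v v' y h h'
    rw [map_mul, Equiv.Perm.mul_apply, h', ← h, ← Equiv.Perm.mul_apply, ← map_mul, inv_mul_cancel,
      map_one, Equiv.Perm.one_apply]
  rcases e₁ with e₁ | e₁
  · have e₃ := e₃.resolve_right fun h => ne ((even e₁).symm.trans (odd h))
    have e₅ := e₅.resolve_right fun h => ne ((even e₁).symm.trans (odd h))
    have coset : ∀ {v : Artin}, act v 1 = w → v ∈ v₁ • (Ahat a : Set Artin) := fun h =>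
      mem_smul_iff.2 (mem_Ahat_a_of_act (mem e₁ h))
    exact ⟨v₁ • (Ahat a : Set Artin), Or.inl ⟨v₁, rfl⟩, ⟨v₁, coset e₁, m₁⟩, ⟨v₃, coset e₃, m₃⟩,
      ⟨v₅, coset e₅, m₅⟩⟩
  · have e₃ := e₃.resolve_left fun h => ne ((even h).symm.trans (odd e₁))
    have e₅ := e₅.resolve_left fun h => ne ((even h).symm.trans (odd e₁))
    have coset : ∀ {v : Artin}, act v (letter 0) = w → v ∈ v₁ • (Ahat b : Set Artin) := fun h =>
      mem_smul_iff.2 (mem_Ahat_b_of_act (mem e₁ h))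
    exact ⟨v₁ • (Ahat b : Set Artin), Or.inr ⟨v₁, rfl⟩, ⟨v₁, coset e₁, m₁⟩, ⟨v₃, coset e₃, m₃⟩,
      ⟨v₅, coset e₅, m₅⟩⟩

end Cosets

end D4Artin

open D4Artin D4Artin.Gen

/-- Every type I 6-cycle in the `D₄` Artin complex satisfies property `(*)`: there is a left
coset of `A_â` or of `A_b̂` meeting each of `x 1`, `x 3`, `x 5`. -/
theorem typeI_six_cycle_property_star (x : Fin 6 → Set Artin) (hx : TypeI x) :
    ∃ z : Set Artin, (IsCosetOf z (Ahat a) ∨ IsCosetOf z (Ahat b)) ∧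
      (z ∩ x 1).Nonempty ∧ (z ∩ x 3).Nonempty ∧ (z ∩ x 5).Nonempty := by
  obtain ⟨⟨k₀, h₀⟩, ⟨k₂, h₂⟩, ⟨k₄, h₄⟩, ⟨g₁, h₁⟩, ⟨g₃, h₃⟩, ⟨g₅, h₅⟩, -, -, -, -, -, -, hx⟩ := hx
  have i₀ := hx 0
  have i₁ := hx 1
  have i₂ := hx 2
  have i₃ := hx 3
  have i₄ := hx 4
  have i₅ := hx 5
  simp only [Fin.reduceAdd, h₀, h₁, h₂, h₃, h₄, h₅] at i₀ i₁ i₂ i₃ i₄ i₅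
  rw [Set.inter_comm] at i₀ i₂ i₄
  obtain ⟨p, hp, q, hq, r, hr, hpq, hpr⟩ := FourInv.IsTame.exists_common (isTame_act g₁)
    (isTame_act g₃) (isTame_act g₅) (exists_act_eq_act i₁ i₂) (exists_act_eq_act i₀ i₅)
    (exists_act_eq_act i₃ i₄)
  rw [h₁, h₃, h₅]
  exact exists_coset hp hq hr hpq hpr
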